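/- arXiv:1805.01998 — 2 statements merged into one kernel-verified Lean document; each statement's English description precedes it below -/
import Mathlib

section
/- Let p be an odd prime, n ≥ 2 an integer, and A, k integers with |A| < p/2, p ∤ A, 1 ≤ k < p−1 and gcd(k, p−1) = 1. Suppose that either n is even and (A, k) is not of the form (±1, 1), or n is odd and (A, k) is not of the form (±1, 1) or (±1, (p+1)/2) (i.e., f(x) is not the map ±x mod p, nor, for odd n, the map ±x^{(p+1)/2} mod p). If p ≥ 9·10^{34}·n^{92/3}, then there are no indices i, j with 0 ≤ i, j ≤ n−1 and f(I_i) ⊆ I_j. -/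
/-- `Iclass p n j` is the residue class `I_j = {x : 1 ≤ x ≤ p-1, x ≡ j (mod n)}`. -/
def Iclass (p n j : ℕ) : Finset ℕ :=
  (Finset.Icc 1 (p - 1)).filter fun x => x % n = j

/-- `fmap p A k x` is `A x^k mod p`, the least residue in `{0, …, p-1}`. -/
def fmap (p : ℕ) (A : ℤ) (k : ℕ) (x : ℕ) : ℕ :=
  ((A : ZMod p) * (x : ZMod p) ^ k).val

namespace PowerMap

open Finset

section Exponential

variable {p : ℕ} [Fact p.Prime]

/-- The sum `∑_{t < m} e(b t / p)`. -/
noncomputable def geom (m : ℕ) (b : ZMod p) : ℂ :=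
  ∑ t ∈ range m, ZMod.stdAddChar (b * (t : ZMod p))

lemma norm_stdAddChar (b : ZMod p) : ‖(ZMod.stdAddChar b : ℂ)‖ = 1 :=
  AddChar.norm_apply _ _

lemma norm_geom_le (m : ℕ) (b : ZMod p) : ‖geom m b‖ ≤ m := by
  refine (norm_sum_le _ _).trans ?_
  simp

lemma geom_neg (m : ℕ) (b : ZMod p) : geom m (-b) = starRingEnd ℂ (geom m b) := by
  simp only [geom, map_sum, neg_mul, AddChar.map_neg_eq_conj]

lemma norm_geom_neg (m : ℕ) (b : ZMod p) : ‖geom m (-b)‖ = ‖geom m b‖ := by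
  rw [geom_neg, RCLike.norm_conj]

lemma abs_norm_geom_sub_le {m m' : ℕ} (h : m ≤ m') (b : ZMod p) :
    |‖geom m' b‖ - ‖geom m b‖| ≤ (m' : ℝ) - m := by
  refine (abs_norm_sub_norm_le _ _).trans ?_
  rw [geom, geom, ← sum_range_add_sum_Ico _ h, add_sub_cancel_left]
  refine (norm_sum_le _ _).trans ?_
  simp [Nat.cast_sub h]

lemma sum_stdAddChar_mul (x : ZMod p) :
    ∑ b : ZMod p, (ZMod.stdAddChar (b * x) : ℂ) = if x = 0 then (p : ℂ) else 0 := by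
  have := AddChar.sum_mulShift x (ZMod.isPrimitive_stdAddChar p)
  simpa [ZMod.card] using this

lemma natCast_inj_of_lt {s t : ℕ} (hs : s < p) (ht : t < p) (h : (s : ZMod p) = t) : s = t := by
  rw [ZMod.natCast_eq_natCast_iff'] at h
  rwa [Nat.mod_eq_of_lt hs, Nat.mod_eq_of_lt ht] at h

lemma sum_norm_geom_sq {m : ℕ} (hm : m ≤ p) : ∑ b : ZMod p, ‖geom m b‖ ^ 2 = p * m := by
  have key : ∑ b : ZMod p, ((‖geom m b‖ : ℂ)) ^ 2 = p * m := by
    have h1 : ∀ b : ZMod p, ((‖geom m b‖ : ℂ)) ^ 2 =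
        ∑ t ∈ range m, ∑ s ∈ range m, ZMod.stdAddChar (b * ((t : ZMod p) - (s : ZMod p))) := by
      intro b
      rw [← Complex.mul_conj', ← geom_neg, geom, geom, sum_mul_sum]
      refine sum_congr rfl fun t _ => sum_congr rfl fun s _ => ?_
      rw [← AddChar.map_add_eq_mul]
      congr 1
      ring
    simp_rw [h1]
    rw [sum_comm]
    have h2 : ∀ t ∈ range m, ∑ b : ZMod p, ∑ s ∈ range m,
        (ZMod.stdAddChar (b * ((t : ZMod p) - (s : ZMod p))) : ℂ) = p := by
      intro t ht
      rw [sum_comm]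
      simp_rw [sum_stdAddChar_mul]
      rw [sum_eq_single_of_mem t ht]
      · simp
      · intro s hs hst
        rw [if_neg]
        intro h0
        exact hst (natCast_inj_of_lt ((mem_range.1 hs).trans_le hm)
          ((mem_range.1 ht).trans_le hm) (sub_eq_zero.1 h0).symm)
    rw [sum_congr rfl h2]
    simp [mul_comm]
  exact_mod_cast key

lemma norm_stdAddChar_intCast_sub_one (j : ℤ) :
    ‖(ZMod.stdAddChar (j : ZMod p) : ℂ) - 1‖ = 2 * |Real.sin (Real.pi * j / p)| := by
  rw [ZMod.stdAddChar_coe]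
  have : (2 * Real.pi * Complex.I * j / p : ℂ) = Complex.I * ((2 * (Real.pi * j / p) : ℝ) : ℂ) := by
    push_cast
    ring
  rw [this, Complex.norm_exp_I_mul_ofReal_sub_one, norm_mul, Real.norm_eq_abs, Real.norm_eq_abs]
  congr 2
  · norm_num
  · congr 1; ring

lemma geom_mul (m : ℕ) (b : ZMod p) :
    geom m b * (ZMod.stdAddChar b - 1) = ZMod.stdAddChar (b * (m : ZMod p)) - 1 := by
  have : geom m b = ∑ t ∈ range m, (ZMod.stdAddChar b : ℂ) ^ t := by
    refine sum_congr rfl fun t _ => ?_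
    rw [← AddChar.map_nsmul_eq_pow, nsmul_eq_mul, mul_comm]
  rw [this, geom_sum_mul, ← AddChar.map_nsmul_eq_pow, nsmul_eq_mul, mul_comm b]

lemma le_norm_stdAddChar_sub_one (b : ZMod p) :
    4 * (b.valMinAbs.natAbs : ℝ) / p ≤ ‖(ZMod.stdAddChar b : ℂ) - 1‖ := by
  have hp : (0 : ℝ) < p := by exact_mod_cast (Fact.out : p.Prime).pos
  conv_rhs => rw [← ZMod.coe_valMinAbs b]
  rw [norm_stdAddChar_intCast_sub_one]
  have h2 : 2 * (b.valMinAbs.natAbs : ℝ) ≤ p := by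
    have := ZMod.natAbs_valMinAbs_le b
    have h3 : 2 * b.valMinAbs.natAbs ≤ p := by omega
    exact_mod_cast h3
  have h4 : ((b.valMinAbs.natAbs : ℕ) : ℝ) = |(b.valMinAbs : ℝ)| := by
    rw [Nat.cast_natAbs, Int.cast_abs]
  have habs : |Real.pi * b.valMinAbs / p| = Real.pi * b.valMinAbs.natAbs / p := by
    rw [abs_div, abs_mul, abs_of_pos Real.pi_pos, abs_of_pos hp, h4]
  have h5 : |Real.pi * b.valMinAbs / p| ≤ Real.pi / 2 := by
    rw [habs, div_le_div_iff₀ hp two_pos]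
    nlinarith [Real.pi_pos]
  have := Real.mul_abs_le_abs_sin h5
  rw [habs] at this
  have h6 : 2 / Real.pi * (Real.pi * b.valMinAbs.natAbs / p) = 2 * b.valMinAbs.natAbs / p := by
    field_simp
  rw [h6] at this
  calc 4 * (b.valMinAbs.natAbs : ℝ) / p = 2 * (2 * b.valMinAbs.natAbs / p) := by ring
    _ ≤ _ := by gcongr

lemma norm_geom_le_div (m : ℕ) {b : ZMod p} (hb : b ≠ 0) :
    ‖geom m b‖ ≤ p / (2 * (b.valMinAbs.natAbs : ℝ)) := by
  have hp : (0 : ℝ) < p := by exact_mod_cast (Fact.out : p.Prime).pos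
  have hb' : (0 : ℝ) < b.valMinAbs.natAbs := by
    have : b.valMinAbs.natAbs ≠ 0 := by simpa using hb
    exact_mod_cast Nat.pos_of_ne_zero this
  have h1 : ‖geom m b‖ * ‖(ZMod.stdAddChar b : ℂ) - 1‖ ≤ 2 := by
    rw [← norm_mul, geom_mul]
    refine (norm_sub_le _ _).trans ?_
    rw [norm_stdAddChar, norm_one]
    norm_num
  have h2 := mul_le_mul_of_nonneg_left (le_norm_stdAddChar_sub_one b) (norm_nonneg (geom m b))
  rw [le_div_iff₀ (by positivity)]
  have h3 := h2.trans h1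
  rw [← mul_div_assoc, div_le_iff₀ hp] at h3
  linarith

lemma le_norm_geom_one {m : ℕ} (hm : 2 * m ≤ p) :
    2 / Real.pi * m ≤ ‖geom m (1 : ZMod p)‖ := by
  have hp : (0 : ℝ) < p := by exact_mod_cast (Fact.out : p.Prime).pos
  have h1 : ‖(ZMod.stdAddChar (1 : ZMod p) : ℂ) - 1‖ ≤ 2 * (Real.pi / p) := by
    have := norm_stdAddChar_intCast_sub_one (p := p) 1
    rw [Int.cast_one] at this
    rw [this, Int.cast_one, mul_one]
    gcongr
    exact Real.abs_sin_le_abs.trans (abs_of_pos (by positivity)).le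
  have h2 : 4 * (m : ℝ) / p ≤ ‖(ZMod.stdAddChar (m : ZMod p) : ℂ) - 1‖ := by
    have := le_norm_stdAddChar_sub_one (m : ZMod p)
    rwa [ZMod.valMinAbs_natCast_of_le_half (by omega), Int.natAbs_natCast] at this
  have h3 : ‖geom m (1 : ZMod p)‖ * ‖(ZMod.stdAddChar (1 : ZMod p) : ℂ) - 1‖
      = ‖(ZMod.stdAddChar (m : ZMod p) : ℂ) - 1‖ := by
    rw [← norm_mul, geom_mul, one_mul]
  have h4 : 4 * (m : ℝ) / p ≤ ‖geom m (1 : ZMod p)‖ * (2 * (Real.pi / p)) :=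
    (h2.trans h3.symm.le).trans (mul_le_mul_of_nonneg_left h1 (norm_nonneg _))
  have hpi := Real.pi_pos
  rw [div_mul_eq_mul_div, div_le_iff₀ hpi]
  have h5 : ‖geom m (1 : ZMod p)‖ * (2 * (Real.pi / p)) =
      (2 * (‖geom m (1 : ZMod p)‖ * Real.pi)) / p := by ring
  rw [h5, div_le_div_iff_of_pos_right hp] at h4
  linarith

end Exponential

section Trapezoid

variable {p : ℕ} [Fact p.Prime]

/-- The arc `{α, α + 1, …, α + L - 1}` of `ZMod p`. -/
def arc (α : ZMod p) (L : ℕ) : Finset (ZMod p) := (range L).image fun t : ℕ => α + (t : ZMod p)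

lemma mem_arc {α x : ZMod p} {L : ℕ} : x ∈ arc α L ↔ ∃ t < L, x = α + (t : ZMod p) := by
  simp [arc, eq_comm]

/-- The normalised convolution of the indicators of an arc of length `m` starting at `α` and of
the arc `{0, …, K - 1}`. -/
noncomputable def trap (α : ZMod p) (m K : ℕ) (x : ZMod p) : ℝ :=
  (∑ s ∈ range K, ∑ t ∈ range m, if x = α + (t : ZMod p) + (s : ZMod p) then (1 : ℝ) else 0) / K

/-- The Fourier coefficients of `trap`. -/
noncomputable def trapCoeff (α : ZMod p) (m K : ℕ) (b : ZMod p) : ℂ :=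
  ZMod.stdAddChar (-(b * α)) * geom m (-b) * geom K (-b) / (p * K)

/-- The absolute values of the Fourier coefficients of `trap`. -/
noncomputable def trapNorm (m K : ℕ) (b : ZMod p) : ℝ := ‖geom m b‖ * ‖geom K b‖ / (p * K)

lemma trapNorm_nonneg (m K : ℕ) (b : ZMod p) : 0 ≤ trapNorm m K b := by
  unfold trapNorm
  positivity

lemma norm_trapCoeff (α : ZMod p) (m K : ℕ) (b : ZMod p) :
    ‖trapCoeff α m K b‖ = trapNorm m K b := by
  rw [trapCoeff, trapNorm, norm_div, norm_mul, norm_mul, norm_stdAddChar, norm_geom_neg,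
    norm_geom_neg, one_mul, norm_mul, Complex.norm_natCast, Complex.norm_natCast]

lemma trapCoeff_neg (α : ZMod p) (m K : ℕ) (b : ZMod p) :
    trapCoeff α m K (-b) = starRingEnd ℂ (trapCoeff α m K b) := by
  rw [trapCoeff, trapCoeff, map_div₀, map_mul, map_mul, ← geom_neg, ← geom_neg,
    ← AddChar.map_neg_eq_conj, neg_mul, map_mul, map_natCast, map_natCast]

lemma trapNorm_neg (m K : ℕ) (b : ZMod p) : trapNorm m K (-b) = trapNorm m K b := by
  rw [trapNorm, trapNorm, norm_geom_neg, norm_geom_neg]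

lemma trap_eq_sum (α : ZMod p) (m K : ℕ) (x : ZMod p) :
    (trap α m K x : ℂ) = ∑ b, trapCoeff α m K b * ZMod.stdAddChar (b * x) := by
  have hp : (p : ℂ) ≠ 0 := by exact_mod_cast (Fact.out : p.Prime).ne_zero
  have h1 : ∀ b : ZMod p, trapCoeff α m K b * ZMod.stdAddChar (b * x) =
      (∑ s ∈ range K, ∑ t ∈ range m,
        ZMod.stdAddChar (b * (x - (α + (t : ZMod p) + (s : ZMod p))))) / (p * K) := by
    intro b
    rw [trapCoeff, geom, geom, div_mul_eq_mul_div, mul_assoc (ZMod.stdAddChar _), sum_mul_sum,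
      sum_comm, mul_sum, sum_mul]
    congr 1
    refine sum_congr rfl fun s _ => ?_
    rw [mul_sum, sum_mul]
    refine sum_congr rfl fun t _ => ?_
    rw [← AddChar.map_add_eq_mul, ← AddChar.map_add_eq_mul, ← AddChar.map_add_eq_mul]
    congr 1
    ring
  simp_rw [h1]
  rw [← sum_div, sum_comm]
  have h2 : ∀ s ∈ range K, ∑ b : ZMod p, ∑ t ∈ range m,
      (ZMod.stdAddChar (b * (x - (α + (t : ZMod p) + (s : ZMod p)))) : ℂ)
      = p * ∑ t ∈ range m, if x = α + (t : ZMod p) + (s : ZMod p) then (1 : ℂ) else 0 := by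
    intro s _
    rw [sum_comm, mul_sum]
    refine sum_congr rfl fun t _ => ?_
    rw [sum_stdAddChar_mul]
    simp [sub_eq_zero]
  rw [sum_congr rfl h2, ← mul_sum, mul_div_mul_left _ _ hp, trap]
  push_cast [apply_ite Complex.ofReal]
  rfl

lemma trap_nonneg (α : ZMod p) (m K : ℕ) (x : ZMod p) : 0 ≤ trap α m K x := by
  refine div_nonneg (sum_nonneg fun s _ => sum_nonneg fun t _ => ?_) (Nat.cast_nonneg _)
  split_ifs <;> norm_num

lemma trap_le_indicator {m : ℕ} (hm : m ≤ p) (α : ZMod p) (K : ℕ) (x : ZMod p) :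
    trap α m K x ≤ if x ∈ arc α (m + K) then 1 else 0 := by
  split_ifs with hx
  · refine div_le_one_of_le₀ ?_ (Nat.cast_nonneg _)
    have h : ∀ s ∈ range K,
        ∑ t ∈ range m, (if x = α + (t : ZMod p) + (s : ZMod p) then (1 : ℝ) else 0) ≤ 1 := by
      intro s _
      rw [← sum_filter, sum_const, nsmul_eq_mul, mul_one]
      norm_cast
      rw [card_le_one]
      intro t ht t' ht'
      rw [mem_filter, mem_range] at ht ht'
      refine natCast_inj_of_lt (ht.1.trans_le hm) (ht'.1.trans_le hm) ?_
      have := ht.2.symm.trans ht'.2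
      simpa using this
    refine (sum_le_sum h).trans ?_
    simp
  · refine (div_eq_zero_iff.2 (Or.inl ?_)).le
    refine sum_eq_zero fun s hs => sum_eq_zero fun t ht => if_neg fun h => hx ?_
    rw [mem_range] at hs ht
    exact mem_arc.2 ⟨t + s, by omega, by rw [h]; push_cast; ring⟩

lemma indicator_le_trap {K : ℕ} (hK : 0 < K) (α : ZMod p) (L : ℕ) (x : ZMod p) :
    (if x ∈ arc α L then 1 else 0) ≤ trap (α - (K : ZMod p)) (L + K) K x := by
  split_ifs with hx
  · obtain ⟨t, ht, rfl⟩ := mem_arc.1 hx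
    have hK' : (0 : ℝ) < K := by exact_mod_cast hK
    rw [trap, one_le_div hK']
    calc (K : ℝ) = ∑ s ∈ range K, 1 := by simp
      _ ≤ _ := by
        refine sum_le_sum fun s hs => ?_
        rw [mem_range] at hs
        have hmem : t + K - s ∈ range (L + K) := mem_range.2 (by omega)
        refine le_trans ?_ (single_le_sum (fun i _ => ?_) hmem)
        · rw [if_pos]
          rw [Nat.cast_sub (by omega)]
          push_cast
          ring
        · split_ifs <;> norm_num
  · exact trap_nonneg _ _ _ _

lemma sum_trap {K : ℕ} (hK : 0 < K) (α : ZMod p) (m : ℕ) : ∑ x, trap α m K x = m := by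
  have hK' : (K : ℝ) ≠ 0 := by exact_mod_cast hK.ne'
  simp only [trap]
  rw [← sum_div, sum_comm]
  have : ∀ s ∈ range K, ∑ x : ZMod p, ∑ t ∈ range m,
      (if x = α + (t : ZMod p) + (s : ZMod p) then (1 : ℝ) else 0) = m := by
    intro s _
    rw [sum_comm]
    simp
  rw [sum_congr rfl this, sum_const, card_range, nsmul_eq_mul]
  field_simp

lemma trapNorm_le (m K : ℕ) (b : ZMod p) : trapNorm m K b ≤ m / p := by
  rcases Nat.eq_zero_or_pos K with rfl | hK
  · simp only [trapNorm, Nat.cast_zero, mul_zero, div_zero]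
    positivity
  have hp : (0 : ℝ) < p := by exact_mod_cast (Fact.out : p.Prime).pos
  have hK' : (0 : ℝ) < K := by exact_mod_cast hK
  rw [trapNorm, div_le_div_iff₀ (by positivity) hp]
  have := mul_le_mul (norm_geom_le m b) (norm_geom_le K b) (norm_nonneg _) (Nat.cast_nonneg _)
  calc ‖geom m b‖ * ‖geom K b‖ * p ≤ m * K * p := by gcongr
    _ = m * (p * K) := by ring

lemma trapNorm_le_norm_geom_div (m K : ℕ) (b : ZMod p) : trapNorm m K b ≤ ‖geom m b‖ / p := by
  rcases Nat.eq_zero_or_pos K with rfl | hK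
  · simp only [trapNorm, Nat.cast_zero, mul_zero, div_zero]
    positivity
  have hp : (0 : ℝ) < p := by exact_mod_cast (Fact.out : p.Prime).pos
  have hK' : (0 : ℝ) < K := by exact_mod_cast hK
  rw [trapNorm, div_le_div_iff₀ (by positivity) hp]
  have := mul_le_mul_of_nonneg_left (norm_geom_le K b) (norm_nonneg (geom m b))
  nlinarith

lemma abs_trapNorm_sub_le {m m' : ℕ} (h : m ≤ m') (K : ℕ) (b : ZMod p) :
    |trapNorm m' K b - trapNorm m K b| ≤ ((m' : ℝ) - m) / p := by
  have hm : (0 : ℝ) ≤ (m' : ℝ) - m := by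
    rw [sub_nonneg]; exact_mod_cast h
  rcases Nat.eq_zero_or_pos K with rfl | hK
  · simp only [trapNorm, Nat.cast_zero, mul_zero, div_zero, sub_self, abs_zero]
    positivity
  have hp : (0 : ℝ) < p := by exact_mod_cast (Fact.out : p.Prime).pos
  have hK' : (0 : ℝ) < K := by exact_mod_cast hK
  rw [trapNorm, trapNorm, ← sub_div, ← sub_mul, abs_div, abs_mul, abs_norm,
    abs_of_pos (mul_pos hp hK'), div_le_div_iff₀ (by positivity) hp]
  have := mul_le_mul (abs_norm_geom_sub_le h b) (norm_geom_le K b) (norm_nonneg _) hm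
  calc |‖geom m' b‖ - ‖geom m b‖| * ‖geom K b‖ * p ≤ ((m' : ℝ) - m) * K * p := by gcongr
    _ = ((m' : ℝ) - m) * (p * K) := by ring

lemma sum_trapNorm_sq_le {m : ℕ} (hm : m ≤ p) (K : ℕ) :
    ∑ b : ZMod p, trapNorm m K b ^ 2 ≤ m / p := by
  have hp : (0 : ℝ) < p := by exact_mod_cast (Fact.out : p.Prime).pos
  calc ∑ b : ZMod p, trapNorm m K b ^ 2 ≤ ∑ b : ZMod p, (‖geom m b‖ / p) ^ 2 := by
        gcongr with b
        · exact trapNorm_nonneg _ _ _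
        · exact trapNorm_le_norm_geom_div _ _ _
    _ = (∑ b : ZMod p, ‖geom m b‖ ^ 2) / (p : ℝ) ^ 2 := by
        simp_rw [div_pow, sum_div]
    _ = m / p := by
        rw [sum_norm_geom_sq hm]
        field_simp

lemma sq_sum_trapNorm_le {m K : ℕ} (hm : m ≤ p) (hK : 0 < K) (hKp : K ≤ p) :
    (∑ b : ZMod p, trapNorm m K b) ^ 2 ≤ (m : ℝ) / K := by
  have hp : (0 : ℝ) < p := by exact_mod_cast (Fact.out : p.Prime).pos
  have hK' : (0 : ℝ) < K := by exact_mod_cast hK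
  simp only [trapNorm]
  rw [← sum_div, div_pow, div_le_div_iff₀ (by positivity) hK']
  have := sum_mul_sq_le_sq_mul_sq univ (fun b : ZMod p => ‖geom m b‖) (fun b => ‖geom K b‖)
  rw [sum_norm_geom_sq hm, sum_norm_geom_sq hKp] at this
  nlinarith

lemma trapNorm_le_inv (m K : ℕ) {b : ZMod p} (hb : b ≠ 0) :
    trapNorm m K b ≤ 1 / (2 * (b.valMinAbs.natAbs : ℝ)) := by
  have hp : (0 : ℝ) < p := by exact_mod_cast (Fact.out : p.Prime).pos
  refine (trapNorm_le_norm_geom_div m K b).trans ?_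
  rw [div_le_iff₀ hp]
  refine (norm_geom_le_div m hb).trans (le_of_eq ?_)
  ring

lemma card_natAbs_valMinAbs_eq_le (k : ℕ) :
    #{b : ZMod p | b.valMinAbs.natAbs = k} ≤ 2 := by
  refine (card_le_card (t := {(k : ZMod p), -(k : ZMod p)}) fun b hb => ?_).trans card_le_two
  rw [mem_filter] at hb
  have h := ZMod.coe_valMinAbs b
  rw [mem_insert, mem_singleton]
  rcases Int.natAbs_eq b.valMinAbs with h1 | h1 <;> rw [h1, hb.2] at h
  · left; rw [← h]; push_cast; rfl
  · right; rw [← h]; push_cast; rfl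

lemma sum_trapNorm_tail_le {T K : ℕ} (hT : 0 < T) (hK : 0 < K) (m : ℕ) :
    ∑ b : ZMod p with T < b.valMinAbs.natAbs, trapNorm m K b ≤ p / (2 * K * T) := by
  have hp : (0 : ℝ) < p := by exact_mod_cast (Fact.out : p.Prime).pos
  have hK' : (0 : ℝ) < K := by exact_mod_cast hK
  have hT' : (0 : ℝ) < T := by exact_mod_cast hT
  have h1 : ∀ b ∈ ({b : ZMod p | T < b.valMinAbs.natAbs} : Finset (ZMod p)),
      trapNorm m K b ≤ p / (4 * K) * ((b.valMinAbs.natAbs : ℝ) ^ 2)⁻¹ := by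
    intro b hb
    rw [mem_filter] at hb
    have hb0 : b ≠ 0 := by
      rintro rfl
      simp at hb
    have hbpos : (0 : ℝ) < b.valMinAbs.natAbs := by exact_mod_cast hT.trans hb.2
    have h2 := mul_le_mul (norm_geom_le_div m hb0) (norm_geom_le_div K hb0) (norm_nonneg _)
      (by positivity)
    calc trapNorm m K b ≤ (p / (2 * (b.valMinAbs.natAbs : ℝ)) * (p / (2 * (b.valMinAbs.natAbs : ℝ))))
          / (p * K) := by unfold trapNorm; gcongr
      _ = _ := by field_simp; ring
  refine (sum_le_sum h1).trans ?_
  rw [← mul_sum]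
  have h3 : ∑ b : ZMod p with T < b.valMinAbs.natAbs, ((b.valMinAbs.natAbs : ℝ) ^ 2)⁻¹ ≤
      2 * (T : ℝ)⁻¹ := by
    have hmaps : ∀ b ∈ ({b : ZMod p | T < b.valMinAbs.natAbs} : Finset (ZMod p)),
        b.valMinAbs.natAbs ∈ Ioc T (T + p) := by
      intro b hb
      rw [mem_filter] at hb
      have := ZMod.natAbs_valMinAbs_le b
      rw [mem_Ioc]
      omega
    rw [← sum_fiberwise_of_maps_to hmaps]
    have h4 : ∀ k ∈ Ioc T (T + p),
        ∑ b ∈ ({b : ZMod p | T < b.valMinAbs.natAbs} : Finset (ZMod p)) with b.valMinAbs.natAbs = k,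
          ((b.valMinAbs.natAbs : ℝ) ^ 2)⁻¹ ≤ 2 * ((k : ℝ) ^ 2)⁻¹ := by
      intro k _
      rw [sum_congr rfl (g := fun _ => ((k : ℝ) ^ 2)⁻¹)
        (fun b hb => by rw [(mem_filter.1 hb).2]), sum_const, nsmul_eq_mul]
      have : #{b ∈ ({b : ZMod p | T < b.valMinAbs.natAbs} : Finset (ZMod p)) |
          b.valMinAbs.natAbs = k} ≤ 2 := by
        refine (card_le_card ?_).trans (card_natAbs_valMinAbs_eq_le (p := p) k)
        exact filter_subset_filter _ (filter_subset _ _)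
      have h5 : (#{b ∈ ({b : ZMod p | T < b.valMinAbs.natAbs} : Finset (ZMod p)) |
          b.valMinAbs.natAbs = k} : ℝ) ≤ 2 := by exact_mod_cast this
      gcongr
    refine (sum_le_sum h4).trans ?_
    rw [← mul_sum]
    have h6 := sum_Ioc_inv_sq_le_sub (α := ℝ) hT.ne' (Nat.le_add_right T p)
    have h7 : (0 : ℝ) ≤ ((T + p : ℕ) : ℝ)⁻¹ := by positivity
    linarith
  calc _ ≤ (p : ℝ) / (4 * K) * (2 * (T : ℝ)⁻¹) := by gcongr
    _ = _ := by field_simp; ring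

lemma le_trapNorm_one {m₀ m K : ℕ} (hm₀ : 2 * m₀ ≤ p) (hm : m₀ ≤ m) (hK : 0 < K)
    (hKp : 2 * K ≤ p) :
    (2 / Real.pi * m₀ - (m - m₀)) * (2 / Real.pi) / p ≤ trapNorm m K (1 : ZMod p) := by
  have hp : (0 : ℝ) < p := by exact_mod_cast (Fact.out : p.Prime).pos
  have hK' : (0 : ℝ) < K := by exact_mod_cast hK
  have h1 := le_norm_geom_one hm₀
  have h2 := le_norm_geom_one hKp
  have h3 := (abs_le.1 (abs_norm_geom_sub_le hm (1 : ZMod p))).1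
  have hpi := Real.pi_pos
  rw [trapNorm, div_le_div_iff₀ hp (by positivity)]
  have h4 : (2 / Real.pi * m₀ - (m - m₀)) * (2 / Real.pi * K) ≤
      ‖geom m (1 : ZMod p)‖ * ‖geom K (1 : ZMod p)‖ := by
    refine mul_le_mul ?_ h2 (by positivity) (norm_nonneg _)
    linarith
  calc _ = (2 / Real.pi * m₀ - (m - m₀)) * (2 / Real.pi * K) * p := by ring
    _ ≤ _ := by gcongr

end Trapezoid

section Correlation

variable {p : ℕ} [Fact p.Prime]

/-- The linear relations between the coordinates of `v`. -/
def relations (v : Fin 4 → ZMod p) : Finset (Fin 4 → ZMod p) :=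
  {a | ∑ j, a j * v j = 0}

lemma mem_relations {v a : Fin 4 → ZMod p} : a ∈ relations v ↔ ∑ j, a j * v j = 0 := by
  simp [relations]

lemma sub_mul_mem_relations {v a b : Fin 4 → ZMod p} (ha : a ∈ relations v)
    (hb : b ∈ relations v) (l : ZMod p) : (fun j => a j - l * b j) ∈ relations v := by
  rw [mem_relations] at *
  simp_rw [sub_mul, mul_assoc, sum_sub_distrib, ← mul_sum, ha, hb]
  simp

lemma sum_prod_eq_sum_relations (c : Fin 4 → ZMod p → ℂ) (v : Fin 4 → ZMod p) :
    ∑ x, ∏ j, ∑ b, c j b * ZMod.stdAddChar (b * (x * v j)) =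
      p * ∑ a ∈ relations v, ∏ j, c j (a j) := by
  have h1 : ∀ x : ZMod p, ∏ j, ∑ b, c j b * (ZMod.stdAddChar (b * (x * v j)) : ℂ) =
      ∑ a : Fin 4 → ZMod p, (∏ j, c j (a j)) * ZMod.stdAddChar (x * ∑ j, a j * v j) := by
    intro x
    rw [prod_univ_sum, Fintype.piFinset_univ]
    refine sum_congr rfl fun a _ => ?_
    rw [prod_mul_distrib]
    congr 1
    simp only [Fin.prod_univ_four, Fin.sum_univ_four, ← AddChar.map_add_eq_mul]
    congr 1
    ring
  simp_rw [h1]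
  rw [sum_comm, relations, sum_filter, mul_sum]
  refine sum_congr rfl fun a _ => ?_
  rw [← mul_sum, sum_stdAddChar_mul]
  split_ifs <;> ring

lemma sum_relations_prod_le {v : Fin 4 → ZMod p} {i : Fin 4} (hv : v i ≠ 0)
    (S : Finset (Fin 4 → ZMod p)) (hS : S ⊆ relations v)
    (g : Fin 4 → ZMod p → ℝ) (hg : ∀ j b, 0 ≤ g j b) {M : ℝ} (hM : ∀ b, g i b ≤ M)
    (hM0 : 0 ≤ M) :
    ∑ a ∈ S, ∏ j, g j (a j) ≤ M * ∏ l : Fin 3, ∑ b, g (i.succAbove l) b := by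
  have hinj : Set.InjOn (fun (a : Fin 4 → ZMod p) (l : Fin 3) => a (i.succAbove l)) S := by
    intro a ha b hb hab
    have ha := mem_relations.1 (hS ha)
    have hb := mem_relations.1 (hS hb)
    have hl : ∀ l, a (i.succAbove l) = b (i.succAbove l) := fun l => congrFun hab l
    rw [Fin.sum_univ_succAbove _ i] at ha hb
    simp_rw [hl] at ha
    have hi : a i = b i := by
      have := ha.trans hb.symm
      exact mul_right_cancel₀ hv (add_right_cancel this)
    funext j
    rcases Fin.eq_self_or_eq_succAbove i j with rfl | ⟨l, rfl⟩
    · exact hi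
    · exact hl l
  calc ∑ a ∈ S, ∏ j, g j (a j)
      ≤ ∑ a ∈ S, M * ∏ l : Fin 3, g (i.succAbove l) (a (i.succAbove l)) := by
        refine sum_le_sum fun a _ => ?_
        rw [Fin.prod_univ_succAbove _ i]
        exact mul_le_mul_of_nonneg_right (hM _) (prod_nonneg fun _ _ => hg _ _)
    _ = M * ∑ d ∈ S.image fun (a : Fin 4 → ZMod p) (l : Fin 3) => a (i.succAbove l),
          ∏ l : Fin 3, g (i.succAbove l) (d l) := by
        rw [sum_image hinj, mul_sum]
    _ ≤ M * ∑ d : Fin 3 → ZMod p, ∏ l : Fin 3, g (i.succAbove l) (d l) := by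
        refine mul_le_mul_of_nonneg_left ?_ hM0
        exact sum_le_univ_sum_of_nonneg fun d => prod_nonneg fun _ _ => hg _ _
    _ = _ := by rw [prod_univ_sum, Fintype.piFinset_univ]

lemma sum_relations_tail_le {v : Fin 4 → ZMod p} (hv : ∀ j, v j ≠ 0) {u : ZMod p → ℝ}
    (hu : ∀ b, 0 ≤ u b) {M τ R : ℝ} (hM : ∀ b, u b ≤ M) (hR : (∑ b, u b) ^ 2 ≤ R) (T : ℕ)
    (hτ : ∑ b : ZMod p with T < b.valMinAbs.natAbs, u b ≤ τ) :
    ∑ a ∈ relations v with ∃ j, T < (a j).valMinAbs.natAbs, ∏ j, u (a j) ≤ 4 * M * τ * R := by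
  have hM0 : 0 ≤ M := (hu 0).trans (hM 0)
  have hone : ∀ j : Fin 4, ∑ a ∈ relations v with T < (a j).valMinAbs.natAbs, ∏ j, u (a j) ≤
      M * τ * R := by
    intro j₀
    obtain ⟨i, hi⟩ : ∃ i : Fin 4, i ≠ j₀ := exists_ne j₀
    obtain ⟨l₀, hl₀⟩ := Fin.exists_succAbove_eq hi.symm
    set g : Fin 4 → ZMod p → ℝ := fun j b =>
      if j = j₀ ∧ ¬ T < b.valMinAbs.natAbs then 0 else u b with hgdef
    have hg : ∀ j b, 0 ≤ g j b := by
      intro j b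
      simp only [hgdef]
      split_ifs
      · exact le_rfl
      · exact hu b
    have h1 : ∑ a ∈ relations v with T < (a j₀).valMinAbs.natAbs, ∏ j, u (a j) =
        ∑ a ∈ relations v with T < (a j₀).valMinAbs.natAbs, ∏ j, g j (a j) := by
      refine sum_congr rfl fun a ha => prod_congr rfl fun j _ => ?_
      rw [mem_filter] at ha
      simp only [hgdef]
      rw [if_neg]
      rintro ⟨rfl, h⟩
      exact h ha.2
    rw [h1]
    refine (sum_relations_prod_le (hv i) _ (filter_subset _ _) g hg (M := M) ?_ hM0).trans ?_
    · intro b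
      simp only [hgdef]
      rw [if_neg (fun h => hi h.1)]
      exact hM b
    · have h2 : ∑ b, g j₀ b ≤ τ := by
        refine le_trans (le_of_eq ?_) hτ
        rw [sum_filter]
        refine sum_congr rfl fun b _ => ?_
        simp only [hgdef]
        by_cases hb : T < b.valMinAbs.natAbs <;> simp [hb]
      have h3 : ∏ l : Fin 3, ∑ b, g (i.succAbove l) b =
          (∑ b, g j₀ b) * (∑ b, u b) ^ 2 := by
        rw [Fin.prod_univ_succAbove _ l₀, hl₀]
        congr 1
        rw [prod_congr rfl (g := fun _ => ∑ b, u b), prod_const, card_univ, Fintype.card_fin]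
        intro l _
        refine sum_congr rfl fun b _ => ?_
        simp only [hgdef]
        rw [if_neg]
        rintro ⟨h, -⟩
        rw [← hl₀] at h
        exact Fin.succAbove_ne l₀ l (Fin.succAbove_right_injective h)
      rw [h3, mul_assoc]
      have h4 : 0 ≤ ∑ b, g j₀ b := sum_nonneg fun b _ => hg _ _
      have h5 : 0 ≤ τ := h4.trans h2
      gcongr
  have hnn : ∀ a : Fin 4 → ZMod p, 0 ≤ ∏ j, u (a j) := fun a => prod_nonneg fun _ _ => hu _
  calc _ ≤ ∑ a ∈ relations v, ∑ j : Fin 4,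
          if T < (a j).valMinAbs.natAbs then ∏ j, u (a j) else 0 := by
        rw [sum_filter]
        refine sum_le_sum fun a _ => ?_
        have hnn' : ∀ j ∈ univ, 0 ≤ if T < (a j).valMinAbs.natAbs then ∏ j, u (a j) else 0 := by
          intro j _
          split_ifs
          · exact hnn a
          · exact le_rfl
        split_ifs with h
        · obtain ⟨j, hj⟩ := h
          refine le_trans ?_ (single_le_sum hnn' (mem_univ j))
          rw [if_pos hj]
        · exact sum_nonneg hnn'
    _ = ∑ j : Fin 4, ∑ a ∈ relations v with T < (a j).valMinAbs.natAbs, ∏ j, u (a j) := by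
        rw [sum_comm]
        simp_rw [sum_filter]
    _ ≤ ∑ _j : Fin 4, M * τ * R := sum_le_sum fun j _ => hone j
    _ = _ := by simp; ring

end Correlation

section Generic

variable {p : ℕ} [Fact p.Prime]

lemma natAbs_valMinAbs_sub_le (a b : ZMod p) :
    (a - b).valMinAbs.natAbs ≤ a.valMinAbs.natAbs + b.valMinAbs.natAbs := by
  have h := (ZMod.natAbs_valMinAbs_add_le a (-b)).trans (Int.natAbs_add_le _ _)
  rwa [ZMod.natAbs_valMinAbs_neg, ← sub_eq_add_neg] at h

lemma natAbs_valMinAbs_mul_of_le {a b : ZMod p}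
    (h : 2 * (a.valMinAbs.natAbs * b.valMinAbs.natAbs) < p) :
    (a * b).valMinAbs.natAbs = a.valMinAbs.natAbs * b.valMinAbs.natAbs := by
  rw [← Int.natAbs_mul] at h ⊢
  congr 1
  rw [ZMod.valMinAbs_spec]
  refine ⟨by push_cast [ZMod.coe_valMinAbs]; rfl, ?_⟩
  rw [Set.mem_Ioc]
  omega

/-- Every nonzero linear relation between the coordinates of `v` with coefficients of absolute
value at most `N` involves all the coordinates. -/
def IsGeneric (N : ℕ) (v : Fin 4 → ZMod p) : Prop :=
  ∀ a ∈ relations v, a ≠ 0 → (∀ j, (a j).valMinAbs.natAbs ≤ N) → ∀ j, a j ≠ 0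

lemma IsGeneric.ne_zero {N : ℕ} {v : Fin 4 → ZMod p} (h : IsGeneric N v) (hN : 0 < N)
    (hp : 2 < p) (j : Fin 4) : v j ≠ 0 := by
  intro hj
  obtain ⟨i, hi⟩ : ∃ i : Fin 4, i ≠ j := exists_ne j
  have h1 : (1 : ZMod p).valMinAbs.natAbs = 1 := by
    have : (1 : ZMod p).valMinAbs = 1 := by
      rw [ZMod.valMinAbs_spec]
      refine ⟨by simp, ?_⟩
      rw [Set.mem_Ioc]
      omega
    rw [this]
    rfl
  refine h (Pi.single j 1) ?_ ?_ ?_ i ?_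
  · rw [mem_relations]
    simp [Pi.single_apply, hj]
  · simp
  · intro l
    rcases eq_or_ne l j with rfl | hl
    · rw [Pi.single_eq_same, h1]
      exact hN
    · rw [Pi.single_eq_of_ne hl]
      simp
  · exact Pi.single_eq_of_ne hi _

/-- The linear relations with coefficients of absolute value at most `T`. -/
def smallRelations (T : ℕ) (v : Fin 4 → ZMod p) : Finset (Fin 4 → ZMod p) :=
  {a ∈ relations v | ∀ j, (a j).valMinAbs.natAbs ≤ T}

lemma mem_smallRelations {T : ℕ} {v a : Fin 4 → ZMod p} :
    a ∈ smallRelations T v ↔ a ∈ relations v ∧ ∀ j, (a j).valMinAbs.natAbs ≤ T := by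
  simp [smallRelations]

lemma IsGeneric.eq_of_apply_eq {T : ℕ} {v a b : Fin 4 → ZMod p} (h : IsGeneric (2 * T) v)
    (ha : a ∈ smallRelations T v) (hb : b ∈ smallRelations T v) {j : Fin 4} (hab : a j = b j) :
    a = b := by
  rw [mem_smallRelations] at ha hb
  by_contra hne
  have h1 := sub_mul_mem_relations ha.1 hb.1 1
  refine h _ h1 ?_ ?_ j ?_
  · intro h0
    refine hne (funext fun i => ?_)
    have := congrFun h0 i
    simpa [sub_eq_zero] using this
  · intro i
    rw [one_mul]
    have := natAbs_valMinAbs_sub_le (a i) (b i)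
    have h2 := ha.2 i
    have h3 := hb.2 i
    omega
  · simp [hab]

lemma sum_relations_eq_add (T : ℕ) (v : Fin 4 → ZMod p) {E : Type*} [AddCommMonoid E]
    (g : (Fin 4 → ZMod p) → E) :
    ∑ a ∈ relations v, g a = ∑ a ∈ smallRelations T v, g a +
      ∑ a ∈ relations v with ∃ j, T < (a j).valMinAbs.natAbs, g a := by
  rw [← sum_filter_add_sum_filter_not (relations v)
    (fun a => ∀ j, (a j).valMinAbs.natAbs ≤ T)]
  simp only [smallRelations, not_forall, not_le]

lemma IsGeneric.sum_smallRelations_eq {T : ℕ} {v : Fin 4 → ZMod p} (h : IsGeneric (2 * T) v)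
    (hv : v 0 + v 1 = v 2 + v 3) (g : (Fin 4 → ZMod p) → ℂ) :
    ∑ a ∈ smallRelations T v, g a =
      ∑ l : ZMod p with l.valMinAbs.natAbs ≤ T, g ![l, l, -l, -l] := by
  symm
  have hmem : ∀ l : ZMod p, l.valMinAbs.natAbs ≤ T → ![l, l, -l, -l] ∈ smallRelations T v := by
    intro l hl
    rw [mem_smallRelations, mem_relations]
    constructor
    · simp only [Fin.sum_univ_four, Matrix.cons_val]
      linear_combination l * hv
    · intro j
      fin_cases j <;> simp [ZMod.natAbs_valMinAbs_neg, hl]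
  refine sum_bij (fun l _ => ![l, l, -l, -l]) ?_ ?_ ?_ ?_
  · intro l hl
    rw [mem_filter] at hl
    exact hmem l hl.2
  · intro l _ l' _ hll
    exact congrFun hll 0
  · intro a ha
    have h0 := (mem_smallRelations.1 ha).2 0
    exact ⟨a 0, by simpa using h0, h.eq_of_apply_eq (hmem _ h0) ha (j := 0) rfl⟩
  · intro _ _
    rfl

lemma eq_one_or_neg_one_of_natAbs_valMinAbs {a : ZMod p} (h : a.valMinAbs.natAbs = 1) :
    a = 1 ∨ a = -1 := by
  have h1 := ZMod.coe_valMinAbs a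
  rcases Int.natAbs_eq a.valMinAbs with h2 | h2 <;> rw [h2, h] at h1
  · left; rw [← h1]; simp
  · right; rw [← h1]; simp

lemma IsGeneric.exists_index {T B : ℕ} {v : Fin 4 → ZMod p} (h : IsGeneric (2 * T) v)
    (hBT : B + B ^ 2 ≤ 2 * T) (hBp : 2 * B ^ 2 < p)
    (hsign : ∀ a ∈ relations v, ¬ ∀ j, (a j).valMinAbs.natAbs = 1) :
    ∃ j₀, ∀ a ∈ relations v, (a j₀).valMinAbs.natAbs = 1 →
      ∃ j, B < (a j).valMinAbs.natAbs := by
  by_contra! hcon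
  obtain ⟨a, ha, ha0, haB⟩ := hcon 0
  have hB2 : B ≤ 2 * T := by omega
  have hane : ∀ j, a j ≠ 0 := by
    refine h a ha ?_ fun j => (haB j).trans hB2
    rintro rfl
    simp at ha0
  obtain ⟨j, hj⟩ := not_forall.1 (hsign a ha)
  obtain ⟨b, hb, hbj, hbB⟩ := hcon j
  have hbne : ∀ j, b j ≠ 0 := by
    refine h b hb ?_ fun j => (hbB j).trans hB2
    rintro rfl
    simp at hbj
  have hbb : b j * b j = 1 := by
    rcases eq_one_or_neg_one_of_natAbs_valMinAbs hbj with h1 | h1 <;> rw [h1] <;> ring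
  have hl : (a j * b j).valMinAbs.natAbs = (a j).valMinAbs.natAbs := by
    rcases eq_one_or_neg_one_of_natAbs_valMinAbs hbj with h1 | h1 <;> rw [h1]
    · rw [mul_one]
    · rw [mul_neg_one, ZMod.natAbs_valMinAbs_neg]
  have hmul : ∀ i, (a j * b j * b i).valMinAbs.natAbs =
      (a j).valMinAbs.natAbs * (b i).valMinAbs.natAbs := by
    intro i
    rw [natAbs_valMinAbs_mul_of_le, hl]
    rw [hl]
    have := Nat.mul_le_mul (haB j) (hbB i)
    nlinarith
  have hzero : (fun i => a i - a j * b j * b i) = 0 := by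
    by_contra hne
    refine h _ (sub_mul_mem_relations ha hb (a j * b j)) hne ?_ j ?_
    · intro i
      have h1 := natAbs_valMinAbs_sub_le (a i) (a j * b j * b i)
      rw [hmul i] at h1
      have := Nat.mul_le_mul (haB j) (hbB i)
      have h2 := haB i
      nlinarith
    · rw [mul_assoc, hbb, mul_one, sub_self]
  have h0 : a 0 = a j * b j * b 0 := by
    have := congrFun hzero 0
    simpa [sub_eq_zero] using this
  have h1 := hmul 0
  rw [← h0, ha0] at h1
  exact hj (Nat.eq_one_of_mul_eq_one_right h1.symm)

lemma IsGeneric.sum_smallRelations_le {T B : ℕ} {v : Fin 4 → ZMod p} (h : IsGeneric (2 * T) v)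
    (hT : 0 < T) (hp : 2 < p) (hB : 0 < B) (hBT : B + B ^ 2 ≤ 2 * T) (hBp : 2 * B ^ 2 < p)
    (hsign : ∀ a ∈ relations v, ¬ ∀ j, (a j).valMinAbs.natAbs = 1)
    {w : ZMod p → ℝ} (hw : ∀ b, 0 ≤ w b) (hneg : ∀ b, w (-b) = w b) {M : ℝ} (hM : ∀ b, w b ≤ M)
    (hinv : ∀ b, b ≠ 0 → w b ≤ 1 / (2 * (b.valMinAbs.natAbs : ℝ))) :
    ∑ a ∈ smallRelations T v, ∏ j, w (a j) ≤
      (∑ b : ZMod p with b.valMinAbs.natAbs ≤ T, w b ^ 4) - w 1 ^ 4 / 2 + M ^ 3 / B := by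
  obtain ⟨j₀, hj₀⟩ := h.exists_index hBT hBp hsign
  have hM0 : 0 ≤ M := (hw 0).trans (hM 0)
  have hB' : (0 : ℝ) < B := by exact_mod_cast hB
  set Q := ∑ b : ZMod p with b.valMinAbs.natAbs ≤ T, w b ^ 4 with hQ
  have hinj : ∀ (S : Finset (Fin 4 → ZMod p)) (_ : S ⊆ smallRelations T v) (j : Fin 4),
      Set.InjOn (fun a : Fin 4 → ZMod p => a j) S :=
    fun S hS j a ha b hb hab => h.eq_of_apply_eq (hS ha) (hS hb) hab
  have hcoord : ∀ (S : Finset (Fin 4 → ZMod p)) (_ : S ⊆ smallRelations T v) (j : Fin 4),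
      ∑ a ∈ S, w (a j) ^ 4 ≤ Q := by
    intro S hS j
    rw [← sum_image (f := fun b => w b ^ 4) (hinj S hS j)]
    refine sum_le_sum_of_subset_of_nonneg ?_ fun b _ _ => pow_nonneg (hw b) 4
    intro b hb
    obtain ⟨a, ha, rfl⟩ := mem_image.1 hb
    exact mem_filter.2 ⟨mem_univ _, (mem_smallRelations.1 (hS ha)).2 j⟩
  have h11 : (1 : ZMod p) ≠ -1 := by
    have : Fact (2 < p) := ⟨hp⟩
    exact fun h => ZMod.neg_one_ne_one h.symm
  have hs1 : (1 : ZMod p).valMinAbs.natAbs = 1 := by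
    have : ((1 : ℕ) : ZMod p).valMinAbs = (1 : ℕ) :=
      ZMod.valMinAbs_natCast_of_le_half (by omega)
    rw [Nat.cast_one] at this
    rw [this]
    rfl
  rw [← sum_filter_add_sum_filter_not (smallRelations T v)
    (fun a => ¬ (a j₀).valMinAbs.natAbs = 1)]
  refine add_le_add ?_ ?_
  · set S := {a ∈ smallRelations T v | ¬ (a j₀).valMinAbs.natAbs = 1} with hS
    have hSs : S ⊆ smallRelations T v := filter_subset _ _
    have h1 : ∀ a ∈ S, ∏ j, w (a j) ≤
        (w (a j₀) ^ 4 + ∑ l : Fin 3, w (a (j₀.succAbove l)) ^ 4) / 4 := by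
      intro a _
      rw [← Fin.sum_univ_succAbove (fun j => w (a j) ^ 4), Fin.prod_univ_four, Fin.sum_univ_four]
      nlinarith [sq_nonneg (w (a 0) ^ 2 - w (a 1) ^ 2), sq_nonneg (w (a 2) ^ 2 - w (a 3) ^ 2),
        sq_nonneg (w (a 0) * w (a 1) - w (a 2) * w (a 3))]
    have h2 : ∑ a ∈ S, w (a j₀) ^ 4 ≤ Q - 2 * w 1 ^ 4 := by
      rw [← sum_image (f := fun b => w b ^ 4) (hinj S hSs j₀)]
      have h3 : ∑ b ∈ {(1 : ZMod p), -1}, w b ^ 4 = 2 * w 1 ^ 4 := by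
        rw [sum_pair h11, hneg]
        ring
      have hdisj : Disjoint (S.image fun a => a j₀) {(1 : ZMod p), -1} := by
        rw [disjoint_left]
        intro b hb hb1
        obtain ⟨a, ha, rfl⟩ := mem_image.1 hb
        refine (mem_filter.1 ha).2 ?_
        rw [mem_insert, mem_singleton] at hb1
        rcases hb1 with h | h <;> simp only [h, ZMod.natAbs_valMinAbs_neg, hs1]
      rw [le_sub_iff_add_le, ← h3, ← sum_union hdisj]
      refine sum_le_sum_of_subset_of_nonneg ?_ fun b _ _ => pow_nonneg (hw b) 4
      intro b hb
      rw [mem_filter]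
      refine ⟨mem_univ _, ?_⟩
      rcases mem_union.1 hb with hb | hb
      · obtain ⟨a, ha, rfl⟩ := mem_image.1 hb
        exact (mem_smallRelations.1 (hSs ha)).2 j₀
      · rw [mem_insert, mem_singleton] at hb
        rcases hb with rfl | rfl
        · rw [hs1]; exact hT
        · rw [ZMod.natAbs_valMinAbs_neg, hs1]; exact hT
    refine (sum_le_sum h1).trans ?_
    rw [← sum_div, sum_add_distrib, sum_comm]
    have h4 : ∑ l : Fin 3, ∑ a ∈ S, w (a (j₀.succAbove l)) ^ 4 ≤ ∑ _l : Fin 3, Q :=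
      sum_le_sum fun l _ => hcoord S hSs _
    rw [sum_const, card_univ, Fintype.card_fin, nsmul_eq_mul] at h4
    push_cast at h4
    linarith
  · set S := {a ∈ smallRelations T v | ¬ ¬ (a j₀).valMinAbs.natAbs = 1} with hS
    have hSs : S ⊆ smallRelations T v := filter_subset _ _
    have hcard : #S ≤ 2 := by
      rw [← card_image_of_injOn (hinj S hSs j₀)]
      refine (card_le_card ?_).trans (card_natAbs_valMinAbs_eq_le (p := p) 1)
      intro b hb
      obtain ⟨a, ha, rfl⟩ := mem_image.1 hb
      exact mem_filter.2 ⟨mem_univ _, not_not.1 (mem_filter.1 ha).2⟩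
    have hterm : ∀ a ∈ S, ∏ j, w (a j) ≤ 1 / (2 * B) * M ^ 3 := by
      intro a ha
      have ha1 := mem_filter.1 ha
      obtain ⟨j, hj⟩ := hj₀ a (mem_smallRelations.1 ha1.1).1 (not_not.1 ha1.2)
      have hne : a j ≠ 0 := by
        intro h0
        rw [h0] at hj
        simp at hj
      rw [Fin.prod_univ_succAbove _ j]
      refine mul_le_mul ?_ ?_ (prod_nonneg fun _ _ => hw _) (by positivity)
      · refine (hinv _ hne).trans ?_
        have : (B : ℝ) ≤ (a j).valMinAbs.natAbs := by exact_mod_cast hj.le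
        gcongr
      · refine (prod_le_prod (fun _ _ => hw _) fun l _ => hM _).trans ?_
        simp
    refine (sum_le_sum hterm).trans ?_
    rw [sum_const, nsmul_eq_mul]
    have h5 : (#S : ℝ) ≤ 2 := by exact_mod_cast hcard
    calc (#S : ℝ) * (1 / (2 * B) * M ^ 3) ≤ 2 * (1 / (2 * B) * M ^ 3) := by gcongr
      _ = _ := by field_simp

end Generic

section Counting

variable {p : ℕ} [Fact p.Prime]

lemma sum_prod_trap_eq (α : ZMod p) (m K : ℕ) (v : Fin 4 → ZMod p) :
    ((∑ x, ∏ j, trap α m K (x * v j) : ℝ) : ℂ) =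
      p * ∑ a ∈ relations v, ∏ j, trapCoeff α m K (a j) := by
  rw [← sum_prod_eq_sum_relations (fun _ => trapCoeff α m K)]
  push_cast
  simp_rw [trap_eq_sum]

lemma norm_prod_trapCoeff (α : ZMod p) (m K : ℕ) (a : Fin 4 → ZMod p) :
    ‖∏ j, trapCoeff α m K (a j)‖ = ∏ j, trapNorm m K (a j) := by
  rw [norm_prod]
  simp_rw [norm_trapCoeff]

lemma norm_sum_tail_le {v : Fin 4 → ZMod p} (hv : ∀ j, v j ≠ 0) (α : ZMod p) {m K T : ℕ}
    (hT : 0 < T) (hK : 0 < K) (hKp : K ≤ p) (hm : m ≤ p) :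
    ‖∑ a ∈ relations v with ∃ j, T < (a j).valMinAbs.natAbs, ∏ j, trapCoeff α m K (a j)‖ ≤
      2 * (m : ℝ) ^ 2 / (K ^ 2 * T) := by
  have hp : (0 : ℝ) < p := by exact_mod_cast (Fact.out : p.Prime).pos
  have hK' : (0 : ℝ) < K := by exact_mod_cast hK
  have hT' : (0 : ℝ) < T := by exact_mod_cast hT
  refine (norm_sum_le _ _).trans ?_
  simp_rw [norm_prod_trapCoeff]
  refine (sum_relations_tail_le hv (trapNorm_nonneg m K) (trapNorm_le m K)
    (sq_sum_trapNorm_le hm hK hKp) T (sum_trapNorm_tail_le hT hK m)).trans (le_of_eq ?_)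
  field_simp
  ring

lemma le_card_of_isGeneric {v : Fin 4 → ZMod p} {T : ℕ} (h : IsGeneric (2 * T) v)
    (hv : v 0 + v 1 = v 2 + v 3) (hp : 2 < p) (α : ZMod p) {m K : ℕ}
    (hT : 0 < T) (hK : 0 < K) (hKp : K ≤ p) (hm : m ≤ p) :
    p * ((∑ b : ZMod p with b.valMinAbs.natAbs ≤ T, trapNorm m K b ^ 4) -
        2 * (m : ℝ) ^ 2 / (K ^ 2 * T)) ≤
      (#{x : ZMod p | ∀ j, x * v j ∈ arc α (m + K)} : ℝ) := by
  have hp0 : (0 : ℝ) < p := by exact_mod_cast (Fact.out : p.Prime).pos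
  have h1 : ∑ x, ∏ j, trap α m K (x * v j) ≤
      (#{x : ZMod p | ∀ j, x * v j ∈ arc α (m + K)} : ℝ) := by
    rw [card_filter, Nat.cast_sum]
    refine sum_le_sum fun x _ => ?_
    refine (prod_le_prod (fun j _ => trap_nonneg _ _ _ _)
      fun j _ => trap_le_indicator hm α K (x * v j)).trans (le_of_eq ?_)
    rw [prod_ite_zero]
    simp
  refine le_trans ?_ h1
  have h2 := congrArg Complex.re (sum_prod_trap_eq α m K v)
  rw [Complex.ofReal_re, sum_relations_eq_add T, h.sum_smallRelations_eq hv,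
    ← Complex.ofReal_natCast, Complex.re_ofReal_mul] at h2
  rw [h2]
  refine mul_le_mul_of_nonneg_left ?_ hp0.le
  rw [Complex.add_re, sub_eq_add_neg]
  refine add_le_add (le_of_eq ?_) ?_
  · rw [Complex.re_sum]
    refine sum_congr rfl fun l _ => ?_
    simp only [Fin.prod_univ_four, Matrix.cons_val, trapCoeff_neg, ← norm_trapCoeff α]
    rw [show ∀ z w : ℂ, z * z * w * w = (z * w) ^ 2 by intros; ring, Complex.mul_conj',
      ← pow_mul]
    norm_cast
  · have h3 := norm_sum_tail_le (h.ne_zero (by omega) hp) α hT hK hKp hm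
    exact (neg_le_neg h3).trans (abs_le.1 (Complex.abs_re_le_norm _)).1

lemma card_le_of_isGeneric {v : Fin 4 → ZMod p} {T B : ℕ} (h : IsGeneric (2 * T) v)
    (hp : 2 < p) (hB : 0 < B) (hBT : B + B ^ 2 ≤ 2 * T) (hBp : 2 * B ^ 2 < p)
    (hsign : ∀ a ∈ relations v, ¬ ∀ j, (a j).valMinAbs.natAbs = 1) (α : ZMod p) {L K : ℕ}
    (hT : 0 < T) (hK : 0 < K) (hm : L + K ≤ p) :
    (#{x : ZMod p | ∀ j, x * v j ∈ arc α L} : ℝ) ≤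
      p * ((∑ b : ZMod p with b.valMinAbs.natAbs ≤ T, trapNorm (L + K) K b ^ 4) -
        trapNorm (L + K) K (1 : ZMod p) ^ 4 / 2 + (((L + K : ℕ) : ℝ) / p) ^ 3 / B +
        2 * ((L + K : ℕ) : ℝ) ^ 2 / (K ^ 2 * T)) := by
  have hp0 : (0 : ℝ) < p := by exact_mod_cast (Fact.out : p.Prime).pos
  have h1 : (#{x : ZMod p | ∀ j, x * v j ∈ arc α L} : ℝ) ≤
      ∑ x, ∏ j, trap (α - (K : ZMod p)) (L + K) K (x * v j) := by
    rw [card_filter, Nat.cast_sum]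
    refine sum_le_sum fun x _ => ?_
    refine le_trans (le_of_eq ?_) (prod_le_prod (fun j _ => ?_)
      fun j _ => indicator_le_trap hK α L (x * v j))
    · rw [prod_ite_zero]
      simp
    · split_ifs <;> norm_num
  refine h1.trans ?_
  have h2 := congrArg Complex.re (sum_prod_trap_eq (α - (K : ZMod p)) (L + K) K v)
  rw [Complex.ofReal_re, sum_relations_eq_add T, ← Complex.ofReal_natCast, Complex.re_ofReal_mul] at h2
  rw [h2]
  refine mul_le_mul_of_nonneg_left ?_ hp0.le
  refine (Complex.re_le_norm _).trans ((norm_add_le _ _).trans (add_le_add ?_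
    (norm_sum_tail_le (h.ne_zero (by omega) hp) _ hT hK (by omega) hm)))
  refine (norm_sum_le _ _).trans ?_
  simp_rw [norm_prod_trapCoeff]
  exact h.sum_smallRelations_le hT hp hB hBT hBp hsign (trapNorm_nonneg _ _)
    (trapNorm_neg _ _) (trapNorm_le _ _) fun b hb => trapNorm_le_inv _ _ hb

lemma sum_trapNorm_pow_four_sub_le {m m' K : ℕ} (hmm : m ≤ m') (hm' : m' ≤ p)
    (S : Finset (ZMod p)) :
    ∑ b ∈ S, trapNorm m' K b ^ 4 - ∑ b ∈ S, trapNorm m K b ^ 4 ≤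
      4 * ((m' : ℝ) / p) ^ 2 * (((m' : ℝ) - m) / p) := by
  have hp0 : (0 : ℝ) < p := by exact_mod_cast (Fact.out : p.Prime).pos
  have hmmR : (m : ℝ) ≤ m' := by exact_mod_cast hmm
  set M : ℝ := (m' : ℝ) / p with hM
  set δ : ℝ := ((m' : ℝ) - m) / p with hδ
  have hM0 : 0 ≤ M := by positivity
  have hδ0 : 0 ≤ δ := div_nonneg (sub_nonneg.2 hmmR) hp0.le
  have h1 : ∀ b ∈ S, trapNorm m' K b ^ 4 - trapNorm m K b ^ 4 ≤
      δ * (2 * M) * (trapNorm m' K b ^ 2 + trapNorm m K b ^ 2) := by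
    intro b _
    have hw := trapNorm_nonneg m' K b
    have hu := trapNorm_nonneg m K b
    have hwM : trapNorm m' K b ≤ M := trapNorm_le m' K b
    have huM : trapNorm m K b ≤ M := (trapNorm_le m K b).trans (by rw [hM]; gcongr)
    have hd := (le_abs_self _).trans (abs_trapNorm_sub_le hmm K b)
    rw [show ∀ x y : ℝ, x ^ 4 - y ^ 4 = (x - y) * (x + y) * (x ^ 2 + y ^ 2) by intros; ring]
    gcongr
    linarith
  rw [← sum_sub_distrib]
  refine (sum_le_sum h1).trans ?_
  have h2 : ∑ b ∈ S, (trapNorm m' K b ^ 2 + trapNorm m K b ^ 2) ≤ 2 * M := by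
    refine (sum_le_univ_sum_of_nonneg fun b => by positivity).trans ?_
    rw [sum_add_distrib]
    have h3 := sum_trapNorm_sq_le (p := p) hm' K
    have h4 := sum_trapNorm_sq_le (p := p) (hmm.trans hm') K
    have h5 : (m : ℝ) / p ≤ M := by rw [hM]; gcongr
    linarith
  rw [← mul_sum]
  calc _ ≤ δ * (2 * M) * (2 * M) := by gcongr
    _ = _ := by ring

end Counting

section SignRelation

lemma numeric_bound {q M κ δ w ℓ B T : ℝ} (hq0 : 0 < q) (hq : q ≤ 1 / 2) (hM0 : 0 ≤ M)
    (hM : M ≤ 1.001 * q) (hκ : 0.999 * q ^ 2 / 2000 ≤ κ) (hδ0 : 0 ≤ δ)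
    (hδ : δ ≤ 1.001 * q ^ 2 / 1000) (hw : 0.4 * q ≤ w) (hB : B * q ^ 3 = 10 ^ 5) (hT : T * q ^ 6 = 10 ^ 10) (hℓ0 : 0 ≤ ℓ)
    (hℓ : ℓ ≤ M) :
    4 * M ^ 2 * δ + M ^ 3 / B + 2 * ℓ ^ 2 / (κ ^ 2 * T) + 2 * M ^ 2 / (κ ^ 2 * T) < w ^ 4 / 2 := by
  have hB' : B = 10 ^ 5 / q ^ 3 := by field_simp; linarith
  have hT' : T = 10 ^ 10 / q ^ 6 := by field_simp; linarith
  have h1 : 4 * M ^ 2 * δ ≤ 0.0041 * q ^ 4 := by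
    calc 4 * M ^ 2 * δ ≤ 4 * (1.001 * q) ^ 2 * (1.001 * q ^ 2 / 1000) := by gcongr
      _ = (4 * 1.001 ^ 3 / 1000) * q ^ 4 := by ring
      _ ≤ _ := by gcongr; norm_num
  have h2 : M ^ 3 / B ≤ 0.0001 * q ^ 4 := by
    rw [hB']
    calc M ^ 3 / (10 ^ 5 / q ^ 3) ≤ (1.001 * q) ^ 3 / (10 ^ 5 / q ^ 3) := by gcongr
      _ = (1.001 ^ 3 / 10 ^ 5 * q ^ 2) * q ^ 4 := by field_simp
      _ ≤ _ := by gcongr; nlinarith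
  have h3 : 2 * M ^ 2 / (κ ^ 2 * T) ≤ 0.001 * q ^ 4 := by
    rw [hT']
    calc 2 * M ^ 2 / (κ ^ 2 * (10 ^ 10 / q ^ 6)) ≤
        2 * (1.001 * q) ^ 2 / ((0.999 * q ^ 2 / 2000) ^ 2 * (10 ^ 10 / q ^ 6)) := by gcongr
      _ = (2 * 1.001 ^ 2 * 2000 ^ 2 / (0.999 ^ 2 * 10 ^ 10)) * q ^ 4 := by field_simp
      _ ≤ _ := by gcongr; norm_num
  have h4 : 2 * ℓ ^ 2 / (κ ^ 2 * T) ≤ 2 * M ^ 2 / (κ ^ 2 * T) := by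
    rw [hT']; gcongr
  have h5 : (0.4 * q) ^ 4 ≤ w ^ 4 := by gcongr
  have h6 : 0 < q ^ 4 := by positivity
  nlinarith

variable {p : ℕ} [Fact p.Prime]

set_option maxHeartbeats 1000000 in
/-- If dilates of a generic additive quadruple `v` are mapped injectively to dilates of a generic
vector `v'`, in such a way that dilates of `v` in an arc of length about `p / n` are mapped to
dilates of `v'` in another such arc, then the coordinates of `v'` satisfy a linear relation with
coefficients `±1`. -/
lemma exists_sign_relation {n L₁ L₂ : ℕ} (hn : 2 ≤ n) (hpn : 10 ^ 30 * n ^ 30 ≤ p)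
    (hL₁ : n * L₁ ≤ p + 2 * n) (hL₁' : p ≤ n * L₁ + 2 * n)
    (hL₂ : n * L₂ ≤ p + 2 * n) (hL₂' : p ≤ n * L₂ + 2 * n)
    (α₁ α₂ : ZMod p) {v v' : Fin 4 → ZMod p} (hv : v 0 + v 1 = v 2 + v 3)
    (hgen : IsGeneric (2 * (10 ^ 10 * n ^ 6)) v) (hgen' : IsGeneric (2 * (10 ^ 10 * n ^ 6)) v')
    {s : ZMod p → ZMod p} (hs : Function.Injective s)
    (hmaps : ∀ t, (∀ j, t * v j ∈ arc α₁ L₁) → ∀ j, s t * v' j ∈ arc α₂ L₂) :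
    ∃ a ∈ relations v', ∀ j, a j = 1 ∨ a j = -1 := by
  by_contra! hcon
  have hsign : ∀ a ∈ relations v', ¬ ∀ j, (a j).valMinAbs.natAbs = 1 := by
    intro a ha hall
    obtain ⟨j, hj, hj'⟩ := hcon a ha
    rcases eq_one_or_neg_one_of_natAbs_valMinAbs (hall j) with h | h
    · exact hj h
    · exact hj' h
  set T : ℕ := 10 ^ 10 * n ^ 6 with hTdef
  set B : ℕ := 10 ^ 5 * n ^ 3 with hBdef
  set K : ℕ := p / (2000 * n ^ 2) with hKdef
  have hn0 : 0 < n := by omega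
  have hn2 : 0 < 2000 * n ^ 2 := by positivity
  have hpow : ∀ i, i ≤ 30 → 10 ^ 30 * n ^ i ≤ p := fun i hi =>
    (Nat.mul_le_mul_left _ (Nat.pow_le_pow_right hn0 hi)).trans hpn
  have hK1 : 2000 * n ^ 2 * K ≤ p := Nat.mul_div_le p _
  have hK2 : p < 2000 * n ^ 2 * (K + 1) := Nat.lt_mul_div_succ p hn2
  have hn4 : 4 ≤ n ^ 2 := by nlinarith
  have hp2 := hpow 2 (by norm_num)
  have hp1 := hpow 1 (by norm_num)
  have hp6 := hpow 6 (by norm_num)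
  have hn6 : 0 < n ^ 6 := by positivity
  rw [pow_one] at hp1
  have hKbig : 10 ^ 20 ≤ K := by
    rw [hKdef, Nat.le_div_iff_mul_le hn2]
    nlinarith
  have hKn : 1000 * n * K ≤ p := by nlinarith
  have hK2p : 2 * K ≤ p := by nlinarith
  have hKL₁ : K ≤ L₁ := by nlinarith
  have hL₁p : L₁ ≤ p := by nlinarith
  have hL₂Kp : L₂ + K ≤ p := by nlinarith
  have hB0 : 0 < B := by positivity
  have hT0 : 0 < T := by positivity
  have hBsq : B ^ 2 = T := by rw [hBdef, hTdef]; ring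
  have hBB : B ≤ B ^ 2 := Nat.le_self_pow two_ne_zero B
  have hlow := le_card_of_isGeneric hgen hv (by omega) α₁ (m := L₁ - K) (K := K) hT0 (by omega)
    (by omega) (by omega)
  rw [Nat.sub_add_cancel hKL₁] at hlow
  have hup := card_le_of_isGeneric hgen' (by omega) hB0 (by omega) (by rw [hBsq]; omega) hsign α₂
    (L := L₂) (K := K) hT0 (by omega) hL₂Kp
  have hcard : #{x : ZMod p | ∀ j, x * v j ∈ arc α₁ L₁} ≤
      #{x : ZMod p | ∀ j, x * v' j ∈ arc α₂ L₂} := by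
    refine card_le_card_of_injOn s (fun t ht => ?_) hs.injOn
    rw [mem_coe, mem_filter] at ht ⊢
    exact ⟨mem_univ _, hmaps t ht.2⟩
  have hcard' : (#{x : ZMod p | ∀ j, x * v j ∈ arc α₁ L₁} : ℝ) ≤
      #{x : ZMod p | ∀ j, x * v' j ∈ arc α₂ L₂} := by exact_mod_cast hcard
  have hp0 : (0 : ℝ) < p := by exact_mod_cast (Fact.out : p.Prime).pos
  have hmain := le_of_mul_le_mul_left ((hlow.trans hcard').trans hup) hp0
  have hLL : L₁ - K ≤ L₂ + K := by
    have : n * L₁ ≤ n * (L₂ + 4) := by nlinarith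
    have := Nat.le_of_mul_le_mul_left this hn0
    omega
  have hdiff := sum_trapNorm_pow_four_sub_le (p := p) (K := K) hLL hL₂Kp
    {b : ZMod p | b.valMinAbs.natAbs ≤ T}
  have hm₀ : p / n ≤ L₂ + K := by
    have h1 : p / n * n ≤ p := Nat.div_mul_le_self p n
    have : n * (p / n) ≤ n * (L₂ + 2) := by nlinarith
    have := Nat.le_of_mul_le_mul_left this hn0
    omega
  have hone := le_trapNorm_one (p := p) (m₀ := p / n) (m := L₂ + K) (K := K)
    ((Nat.mul_le_mul_right _ hn).trans (Nat.mul_div_le p n)) hm₀ (by omega) hK2p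
  -- pass to quantities normalised by `p`
  have hnR : (0 : ℝ) < n := by exact_mod_cast hn0
  set q : ℝ := 1 / n with hq
  have hq0 : 0 < q := by positivity
  have hqn : q * n = 1 := by rw [hq]; field_simp
  have hq2 : q ≤ 1 / 2 := by
    rw [hq]
    have : (2 : ℝ) ≤ n := by exact_mod_cast hn
    gcongr
  have hqq : q ^ 2 ≤ q / 2 := by nlinarith
  have hqq0 : 0 ≤ q ^ 2 := sq_nonneg q
  have hinv : 1 / (p : ℝ) ≤ q ^ 2 / 10 ^ 30 := by
    rw [hq, div_pow, one_pow, div_div, div_le_div_iff_of_pos_left one_pos hp0 (by positivity)]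
    have : ((10 ^ 30 * n ^ 2 : ℕ) : ℝ) ≤ p := by exact_mod_cast hp2
    push_cast at this
    linarith
  have hκ1 : (K : ℝ) / p ≤ q ^ 2 / 2000 := by
    rw [hq, div_pow, one_pow, div_div, div_le_div_iff₀ hp0 (by positivity)]
    have : ((2000 * n ^ 2 * K : ℕ) : ℝ) ≤ p := by exact_mod_cast hK1
    push_cast at this
    linarith
  have hκ2 : 0.999 * q ^ 2 / 2000 ≤ (K : ℝ) / p := by
    have h1 : q ^ 2 / 2000 ≤ (K : ℝ) / p + 1 / p := by
      rw [← add_div, hq, div_pow, one_pow, div_div, div_le_div_iff₀ (by positivity) hp0]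
      have : ((p : ℕ) : ℝ) ≤ (2000 * n ^ 2 * (K + 1) : ℕ) := by exact_mod_cast hK2.le
      push_cast at this
      linarith
    linarith
  have hLq : ∀ L : ℕ, n * L ≤ p + 2 * n → (L : ℝ) / p ≤ q + 2 * (1 / p) := by
    intro L hL
    have : ((n * L : ℕ) : ℝ) ≤ (p + 2 * n : ℕ) := by exact_mod_cast hL
    push_cast at this
    rw [show q + 2 * (1 / (p : ℝ)) = (p + 2 * n) * q / p by
      field_simp; linear_combination (-2) * hqn]
    gcongr
    calc (L : ℝ) = n * L * q := by linear_combination (-(L : ℝ)) * hqn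
      _ ≤ _ := by gcongr
  have hLq' : ∀ L : ℕ, p ≤ n * L + 2 * n → q - 2 * (1 / p) ≤ (L : ℝ) / p := by
    intro L hL
    have : ((p : ℕ) : ℝ) ≤ (n * L + 2 * n : ℕ) := by exact_mod_cast hL
    push_cast at this
    rw [show q - 2 * (1 / (p : ℝ)) = (p - 2 * n) * q / p by
      field_simp; linear_combination 2 * hqn]
    gcongr
    calc (p - 2 * n) * q ≤ n * L * q := by gcongr; linarith
      _ = L := by linear_combination (L : ℝ) * hqn
  have hL₁q := hLq L₁ hL₁
  have hL₂q := hLq L₂ hL₂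
  have hL₁q' := hLq' L₁ hL₁'
  have hL₂q' := hLq' L₂ hL₂'
  have hM : ((L₂ + K : ℕ) : ℝ) / p ≤ 1.001 * q := by
    push_cast
    rw [add_div]
    linarith
  have hδ : (((L₂ + K : ℕ) : ℝ) - (L₁ - K : ℕ)) / p ≤ 1.001 * q ^ 2 / 1000 := by
    rw [Nat.cast_sub hKL₁]
    push_cast
    rw [show ((L₂ : ℝ) + K - (L₁ - K)) / p = L₂ / p - L₁ / p + 2 * (K / p) by ring]
    linarith
  have hℓ : ((L₁ - K : ℕ) : ℝ) / p ≤ ((L₂ + K : ℕ) : ℝ) / p := by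
    have : ((L₁ - K : ℕ) : ℝ) ≤ (L₂ + K : ℕ) := by exact_mod_cast hLL
    gcongr
  have hδ0 : 0 ≤ (((L₂ + K : ℕ) : ℝ) - (L₁ - K : ℕ)) / p := by
    refine div_nonneg (sub_nonneg.2 ?_) hp0.le
    exact_mod_cast hLL
  have hw : 0.4 * q ≤ trapNorm (L₂ + K) K (1 : ZMod p) := by
    refine le_trans ?_ hone
    have hm0 : 0.999 * q ≤ ((p / n : ℕ) : ℝ) / p := by
      have h1 : p ≤ n * (p / n) + 2 * n := by
        have := Nat.lt_mul_div_succ p hn0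
        linarith
      have := hLq' _ h1
      linarith
    have hc : (0.636 : ℝ) ≤ 2 / Real.pi := by
      rw [le_div_iff₀ Real.pi_pos]
      have := Real.pi_lt_d4
      linarith
    rw [show ∀ a b c d : ℝ, (a * b - (c - b)) * a / d = (a * (b / d) - (c / d - b / d)) * a by
      intros; ring]
    calc 0.4 * q ≤ (0.636 * (0.999 * q) - (1.001 * q - 0.999 * q)) * 0.636 := by linarith
      _ ≤ _ := by
        have : 0.636 * (0.999 * q) ≤ 2 / Real.pi * (((p / n : ℕ) : ℝ) / p) := by gcongr
        refine mul_le_mul (by linarith) hc (by norm_num) ?_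
        linarith
  have hBq : (B : ℝ) * q ^ 3 = 10 ^ 5 := by
    rw [hBdef]
    push_cast
    rw [mul_assoc, ← mul_pow, mul_comm (n : ℝ), hqn]
    norm_num
  have hTq : (T : ℝ) * q ^ 6 = 10 ^ 10 := by
    rw [hTdef]
    push_cast
    rw [mul_assoc, ← mul_pow, mul_comm (n : ℝ), hqn]
    norm_num
  have hfinal := numeric_bound (ℓ := ((L₁ - K : ℕ) : ℝ) / p) hq0 hq2 (by positivity) hM hκ2 hδ0 hδ hw
    hBq hTq (by positivity) hℓ
  have htail : ∀ x : ℝ, 2 * (x / p) ^ 2 / (((K : ℝ) / p) ^ 2 * T) = 2 * x ^ 2 / (K ^ 2 * T) := by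
    intro x
    have hK0 : (K : ℝ) ≠ 0 := by
      have : K ≠ 0 := by omega
      exact_mod_cast this
    have hT0 : (T : ℝ) ≠ 0 := by exact_mod_cast hT0.ne'
    field_simp
  rw [htail, htail] at hfinal
  linarith

end SignRelation

section Exceptional

variable {p : ℕ} [Fact p.Prime]

/-- The additive quadruples. -/
def quads (p : ℕ) [Fact p.Prime] : Finset (Fin 4 → ZMod p) := {v | v 0 + v 1 = v 2 + v 3}

lemma mem_quads {v : Fin 4 → ZMod p} : v ∈ quads p ↔ v 0 + v 1 = v 2 + v 3 := by simp [quads]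

lemma card_quads_relation_le {H : ZMod p → ZMod p} (hH : Function.Injective H)
    {a : Fin 4 → ZMod p} (ha : a ≠ 0) {j : Fin 4} (hj : a j = 0) :
    #{v ∈ quads p | a ∈ relations (H ∘ v)} ≤ p ^ 2 := by
  obtain ⟨i, hi⟩ := Function.ne_iff.1 ha
  have hij : i ≠ j := by
    rintro rfl
    exact hi hj
  have hcard : Fintype.card ({l : Fin 4 // l ≠ i ∧ l ≠ j} → ZMod p) = p ^ 2 := by
    rw [Fintype.card_fun, ZMod.card]
    congr 1
    clear hj ha hi
    revert i j
    decide
  rw [← hcard, ← card_univ]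
  refine card_le_card_of_injOn (fun v l => v l.1) (fun _ _ => mem_coe.2 (mem_univ _)) ?_
  intro v hv w hw hvw
  rw [mem_coe, mem_filter, mem_relations] at hv hw
  have hl : ∀ l, l ≠ i → l ≠ j → v l = w l := fun l h1 h2 => congrFun hvw ⟨l, h1, h2⟩
  have hvi : v i = w i := by
    have h1 : ∑ l, a l * (H (v l) - H (w l)) = 0 := by
      simp_rw [mul_sub, sum_sub_distrib]
      exact sub_eq_zero.2 (hv.2.trans hw.2.symm)
    rw [sum_eq_single i] at h1
    · exact hH (sub_eq_zero.1 ((mul_eq_zero.1 h1).resolve_left hi))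
    · intro l _ hli
      rcases eq_or_ne l j with rfl | hlj
      · rw [hj, zero_mul]
      · rw [hl l hli hlj, sub_self, mul_zero]
    · simp
  have hl' : ∀ l, l ≠ j → v l = w l := by
    intro l hlj
    rcases eq_or_ne l i with rfl | hli
    · exact hvi
    · exact hl l hli hlj
  have hv' := mem_quads.1 hv.1
  have hw' := mem_quads.1 hw.1
  funext l
  rcases eq_or_ne l j with rfl | hlj
  · have h0 := hl' 0
    have h1 := hl' 1
    have h2 := hl' 2
    have h3 := hl' 3
    fin_cases l <;> simp at h0 h1 h2 h3 ⊢
    · linear_combination hv' - hw' - h1 + h2 + h3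
    · linear_combination hv' - hw' - h0 + h2 + h3
    · linear_combination -hv' + hw' + h0 + h1 - h3
    · linear_combination -hv' + hw' + h0 + h1 - h2
  · exact hl' l hlj

lemma card_natAbs_valMinAbs_le (N : ℕ) :
    #{b : ZMod p | b.valMinAbs.natAbs ≤ N} ≤ 2 * (N + 1) := by
  have h : ∀ b ∈ ({b : ZMod p | b.valMinAbs.natAbs ≤ N} : Finset (ZMod p)),
      b.valMinAbs.natAbs ∈ range (N + 1) := by
    intro b hb
    rw [mem_filter] at hb
    exact mem_range.2 (by omega)
  have := card_le_mul_card_image_of_maps_to h 2 fun k _ =>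
    (card_le_card (filter_subset_filter _ (filter_subset _ _))).trans
      (card_natAbs_valMinAbs_eq_le (p := p) k)
  rwa [card_range] at this

open Classical in
lemma card_not_isGeneric_le {H : ZMod p → ZMod p} (hH : Function.Injective H) (N : ℕ) :
    #{v ∈ quads p | ¬ IsGeneric N (H ∘ v)} ≤ 4 * (2 * (N + 1)) ^ 3 * p ^ 2 := by
  set C : Fin 4 → Finset (Fin 4 → ZMod p) := fun j =>
    {a | a j = 0 ∧ a ≠ 0 ∧ ∀ i, (a i).valMinAbs.natAbs ≤ N} with hC
  have hCcard : ∀ j, #(C j) ≤ (2 * (N + 1)) ^ 3 := by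
    intro j
    have h1 : #(C j) ≤ #(Fintype.piFinset fun _ : Fin 3 =>
        ({b : ZMod p | b.valMinAbs.natAbs ≤ N} : Finset (ZMod p))) := by
      refine card_le_card_of_injOn (fun a l => a (j.succAbove l)) (fun a ha => ?_) ?_
      · rw [mem_coe, mem_filter] at ha
        rw [mem_coe, Fintype.mem_piFinset]
        exact fun l => mem_filter.2 ⟨mem_univ _, ha.2.2.2 _⟩
      · intro a ha b hb hab
        rw [mem_coe, mem_filter] at ha hb
        funext i
        rcases Fin.eq_self_or_eq_succAbove j i with rfl | ⟨l, rfl⟩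
        · rw [ha.2.1, hb.2.1]
        · exact congrFun hab l
    refine h1.trans ?_
    rw [Fintype.card_piFinset, prod_const, card_univ, Fintype.card_fin]
    exact Nat.pow_le_pow_left (card_natAbs_valMinAbs_le N) 3
  have hsub : ({v ∈ quads p | ¬ IsGeneric N (H ∘ v)} : Finset _) ⊆
      univ.biUnion fun j : Fin 4 => (C j).biUnion fun a =>
        {v ∈ quads p | a ∈ relations (H ∘ v)} := by
    intro v hv
    rw [mem_filter] at hv
    obtain ⟨hv, hgen⟩ := hv
    unfold IsGeneric at hgen
    push Not at hgen
    obtain ⟨a, ha, ha0, haN, j, hj⟩ := hgen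
    simp only [mem_biUnion]
    exact ⟨j, mem_univ _, a, mem_filter.2 ⟨mem_univ _, hj, ha0, haN⟩, mem_filter.2 ⟨hv, ha⟩⟩
  refine (card_le_card hsub).trans ?_
  refine (card_biUnion_le_card_mul _ _ ((2 * (N + 1)) ^ 3 * p ^ 2) fun j _ => ?_).trans ?_
  · refine (card_biUnion_le_card_mul _ _ (p ^ 2) fun a ha => ?_).trans ?_
    · rw [mem_filter] at ha
      exact card_quads_relation_le hH ha.2.2.1 ha.2.1
    · exact Nat.mul_le_mul_right _ (hCcard j)
  · rw [card_univ, Fintype.card_fin, mul_assoc]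

/-- The coefficients `1` and `-1`. -/
def IsSign (a : ZMod p) : Prop := a = 1 ∨ a = -1

lemma IsSign.mul {a b : ZMod p} (ha : IsSign a) (hb : IsSign b) : IsSign (a * b) := by
  rcases ha with rfl | rfl <;> rcases hb with rfl | rfl <;> simp [IsSign]

lemma IsSign.mul_self {a : ZMod p} (ha : IsSign a) : a * a = 1 := by
  rcases ha with rfl | rfl <;> simp

lemma IsSign.add {a b : ZMod p} (ha : IsSign a) (hb : IsSign b) :
    a + b ∈ ({0, 2, -2} : Finset (ZMod p)) := by
  rcases ha with rfl | rfl <;> rcases hb with rfl | rfl <;> norm_num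

/-- The coordinates of `v` satisfy a linear relation with coefficients `±1`. -/
def HasSignRelation (v : Fin 4 → ZMod p) : Prop := ∃ a ∈ relations v, ∀ j, IsSign (a j)

lemma HasSignRelation.of_smul {F : ZMod p → ZMod p} (hmul : ∀ x y, F (x * y) = F x * F y)
    (hF0 : ∀ x, x ≠ 0 → F x ≠ 0)
    {v : Fin 4 → ZMod p} {l : ZMod p} (hl : l ≠ 0)
    (h : HasSignRelation (F ∘ fun j => l * v j)) : HasSignRelation (F ∘ v) := by
  obtain ⟨a, ha, hs⟩ := h
  refine ⟨a, ?_, hs⟩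
  rw [mem_relations] at ha ⊢
  have : F l * ∑ j, a j * (F ∘ v) j = 0 := by
    rw [← ha, mul_sum]
    refine sum_congr rfl fun j _ => ?_
    simp only [Function.comp_apply, hmul]
    ring
  exact (mul_eq_zero.1 this).resolve_left (hF0 l hl)

open Classical in
/-- The additive quadruples whose images under `F` satisfy no relation with coefficients `±1`. -/
noncomputable def badQuads (F : ZMod p → ZMod p) : Finset (Fin 4 → ZMod p) :=
  {v ∈ quads p | ¬ HasSignRelation (F ∘ v)}

lemma mem_badQuads {F : ZMod p → ZMod p} {v : Fin 4 → ZMod p} :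
    v ∈ badQuads F ↔ v ∈ quads p ∧ ¬ HasSignRelation (F ∘ v) := by
  simp [badQuads]

lemma card_badQuads_le {F : ZMod p → ZMod p} (hF : Function.Injective F) {N : ℕ}
    (h : ∀ v ∈ quads p, IsGeneric N v → IsGeneric N (F ∘ v) → HasSignRelation (F ∘ v)) :
    #(badQuads F) ≤ 8 * (2 * (N + 1)) ^ 3 * p ^ 2 := by
  classical
  have hsub : badQuads F ⊆ ({v ∈ quads p | ¬ IsGeneric N (id ∘ v)} : Finset _) ∪
      ({v ∈ quads p | ¬ IsGeneric N (F ∘ v)} : Finset _) := by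
    intro v hv
    rw [mem_badQuads] at hv
    rw [mem_union, mem_filter, mem_filter]
    by_contra! hcon
    exact hv.2 (h v hv.1 (hcon.1 hv.1) (hcon.2 hv.1))
  have h1 := card_not_isGeneric_le (p := p) Function.injective_id N
  have h2 := card_not_isGeneric_le hF N
  refine (card_le_card hsub).trans ((card_union_le _ _).trans ((add_le_add h1 h2).trans ?_))
  apply le_of_eq
  ring

lemma card_badQuads_fiber_le {F : ZMod p → ZMod p} (hmul : ∀ x y, F (x * y) = F x * F y)
    (hF0 : ∀ x, x ≠ 0 → F x ≠ 0) {x : ZMod p} (hx : x ≠ 0) (i : Fin 4) :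
    (p - 1) * #{v ∈ badQuads F | v i = x} ≤ #(badQuads F) := by
  have h1 : #((univ : Finset (ZMod p)).erase 0) = p - 1 := by
    rw [card_erase_of_mem (mem_univ _), card_univ, ZMod.card]
  rw [← h1, ← card_product]
  refine card_le_card_of_injOn (fun q j => q.1 * q.2 j) ?_ ?_
  · rintro ⟨l, v⟩ hq
    rw [mem_coe, mem_product, mem_erase, mem_filter] at hq
    obtain ⟨⟨hl, -⟩, hv, -⟩ := hq
    rw [mem_badQuads] at hv
    rw [mem_coe, mem_badQuads]
    refine ⟨?_, fun h => hv.2 (h.of_smul hmul hF0 hl)⟩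
    have := mem_quads.1 hv.1
    rw [mem_quads]
    linear_combination l * this
  · rintro ⟨l, v⟩ hq ⟨l', v'⟩ hq' heq
    rw [mem_coe, mem_product, mem_erase, mem_filter] at hq hq'
    dsimp only at hq hq'
    have hj : ∀ j, l * v j = l' * v' j := fun j => congrFun heq j
    have hll : l = l' := by
      have := hj i
      rw [hq.2.2, hq'.2.2] at this
      exact mul_right_cancel₀ hx this
    subst hll
    have hvv : v = v' := funext fun j => mul_left_cancel₀ hq.1.1 (hj j)
    rw [hvv]

lemma card_affine_relation_le {F : ZMod p → ZMod p} (hF : Function.Injective F) (e₀ : ZMod p)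
    {e : Fin 3 → ZMod p} (he : e ≠ 0) :
    #{u : Fin 3 → ZMod p | e₀ + ∑ i, e i * F (u i) = 0} ≤ p ^ 2 := by
  obtain ⟨i, hi⟩ := Function.ne_iff.1 he
  have hcard : Fintype.card (Fin 2 → ZMod p) = p ^ 2 := by simp [ZMod.card]
  rw [← hcard, ← card_univ]
  refine card_le_card_of_injOn (fun u l => u (i.succAbove l)) (fun _ _ => mem_coe.2 (mem_univ _)) ?_
  intro u hu w hw huw
  rw [mem_coe, mem_filter, Fin.sum_univ_succAbove _ i] at hu hw
  have hl : ∀ l, u (i.succAbove l) = w (i.succAbove l) := fun l => congrFun huw l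
  have h1 := hu.2.trans hw.2.symm
  simp_rw [hl] at h1
  have h2 : e i * (F (u i) - F (w i)) = 0 := by linear_combination h1
  have h3 := hF (sub_eq_zero.1 ((mul_eq_zero.1 h2).resolve_left hi))
  funext j
  rcases Fin.eq_self_or_eq_succAbove i j with rfl | ⟨l, rfl⟩
  · exact h3
  · exact hl l

end Exceptional

section Rigidity

variable {p : ℕ} [Fact p.Prime]

lemma card_mem_badQuads_le {F : ZMod p → ZMod p} {E : ℕ}
    (hfib : ∀ x, x ≠ 0 → ∀ i, #{v ∈ badQuads F | v i = x} ≤ E * p)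
    {x : ZMod p} (hx : x ≠ 0) (i : Fin 4) (Q : (Fin 3 → ZMod p) → Fin 4 → ZMod p)
    (hQ : ∀ u, Q u i = x) (l : Fin 3) (hinj : ∀ u u', Q u = Q u' → u l = u' l → u = u') :
    #{u : Fin 3 → ZMod p | Q u ∈ badQuads F} ≤ E * p ^ 2 := by
  have h1 : #{u : Fin 3 → ZMod p | Q u ∈ badQuads F} ≤
      #({v ∈ badQuads F | v i = x} ×ˢ (univ : Finset (ZMod p))) := by
    refine card_le_card_of_injOn (fun u => (Q u, u l)) (fun u hu => ?_) ?_
    · rw [mem_coe, mem_filter] at hu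
      rw [mem_coe, mem_product, mem_filter]
      exact ⟨⟨hu.2, hQ u⟩, mem_univ _⟩
    · intro u _ u' _ huu
      rw [Prod.mk.injEq] at huu
      exact hinj u u' huu.1 huu.2
  refine h1.trans ?_
  rw [card_product, card_univ, ZMod.card, sq, ← mul_assoc]
  exact Nat.mul_le_mul_right _ (hfib x hx i)

lemma exists_eq_of_badQuads {F : ZMod p → ZMod p} (hF : Function.Injective F)
    (hF1 : F 1 = 1) (hFn1 : F (-1) = -1) {E : ℕ}
    (hfib : ∀ x, x ≠ 0 → ∀ i, #{v ∈ badQuads F | v i = x} ≤ E * p) (hE : 4 * E + 324 < p)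
    {x : ZMod p} (hx : x ≠ 0) (hx2 : x + 2 ≠ 0) :
    ∃ s c, IsSign s ∧ c ∈ ({0, 2, -2} : Finset (ZMod p)) ∧ F (x + 2) = s * F x + c := by
  set C : Finset (ZMod p) := {0, 2, -2} with hC
  set S : Finset (ZMod p) := {1, -1} with hS
  have hCcard : #C ≤ 3 := card_le_three
  have hScard : #S ≤ 2 := card_le_two
  have hSmem : ∀ {a : ZMod p}, IsSign a ↔ a ∈ S := by simp [IsSign, hS]
  have hp0 : 0 < p := by omega
  set Q : Fin 4 → (Fin 3 → ZMod p) → Fin 4 → ZMod p := ![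
    fun u => ![x, u 0, u 1, x + u 0 - u 1],
    fun u => ![1, u 2, u 0, 1 + u 2 - u 0],
    fun u => ![x + u 0 - u 1, 1 + u 2 - u 0, -1, x + 2 + u 2 - u 1],
    fun u => ![x + 2, u 2, u 1, x + 2 + u 2 - u 1]] with hQ
  have hbad : ∀ r, #{u : Fin 3 → ZMod p | Q r u ∈ badQuads F} ≤ E * p ^ 2 := by
    have hfun : ∀ u u' : Fin 3 → ZMod p, u 0 = u' 0 → u 1 = u' 1 → u 2 = u' 2 → u = u' := by
      intro u u' h0 h1 h2
      funext l
      fin_cases l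
      · exact h0
      · exact h1
      · exact h2
    intro r
    fin_cases r
    · refine card_mem_badQuads_le hfib hx 0 _ (fun u => by simp [hQ]) 2 fun u u' h h2 => ?_
      have h0 : u 0 = u' 0 := by simpa [hQ] using congrFun h 1
      have h1 : u 1 = u' 1 := by simpa [hQ] using congrFun h 2
      exact hfun _ _ h0 h1 h2
    · refine card_mem_badQuads_le hfib one_ne_zero 0 _ (fun u => by simp [hQ]) 1
        fun u u' h h1 => ?_
      have h2 : u 2 = u' 2 := by simpa [hQ] using congrFun h 1
      have h0 : u 0 = u' 0 := by simpa [hQ] using congrFun h 2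
      exact hfun _ _ h0 h1 h2
    · refine card_mem_badQuads_le hfib (neg_ne_zero.2 one_ne_zero) 2 _ (fun u => by simp [hQ]) 0
        fun u u' h h0 => ?_
      have ha : x + u 0 - u 1 = x + u' 0 - u' 1 := by simpa [hQ] using congrFun h 0
      have hb : 1 + u 2 - u 0 = 1 + u' 2 - u' 0 := by simpa [hQ] using congrFun h 1
      exact hfun _ _ h0 (by linear_combination h0 - ha) (by linear_combination hb + h0)
    · refine card_mem_badQuads_le hfib hx2 0 _ (fun u => by simp [hQ]) 0 fun u u' h h0 => ?_
      have h2 : u 2 = u' 2 := by simpa [hQ] using congrFun h 1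
      have h1 : u 1 = u' 1 := by simpa [hQ] using congrFun h 2
      exact hfun _ _ h0 h1 h2
  set P : Finset ((ZMod p × ZMod p × ZMod p) × (Fin 3 → ZMod p)) :=
    (S ×ˢ S ×ˢ C) ×ˢ (Fintype.piFinset fun _ : Fin 3 => C).erase 0 with hP
  have hPcard : #P ≤ 324 := by
    rw [hP, card_product, card_product, card_product]
    have h1 : #((Fintype.piFinset fun _ : Fin 3 => C).erase 0) ≤ 27 := by
      refine (card_le_card (erase_subset _ _)).trans ?_
      rw [Fintype.card_piFinset, prod_const, card_univ, Fintype.card_fin]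
      exact (Nat.pow_le_pow_left hCcard 3).trans (by norm_num)
    calc _ ≤ (2 * (2 * 3)) * 27 := by gcongr
      _ = 324 := by norm_num
  set X : Finset (Fin 3 → ZMod p) :=
    (univ.biUnion fun r => {u : Fin 3 → ZMod p | Q r u ∈ badQuads F}) ∪
    P.biUnion fun q => {u : Fin 3 → ZMod p |
      (q.1.1 * F (x + 2) + q.1.2.1 * F x + q.1.2.2) + ∑ i, q.2 i * F (u i) = 0} with hX
  have hXcard : #X < #(univ : Finset (Fin 3 → ZMod p)) := by
    have h1 : #X ≤ 4 * (E * p ^ 2) + 324 * p ^ 2 := by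
      refine (card_union_le _ _).trans (add_le_add ?_ ?_)
      · refine (card_biUnion_le_card_mul _ _ _ fun r _ => hbad r).trans ?_
        rw [card_univ, Fintype.card_fin]
      · refine (card_biUnion_le_card_mul _ _ (p ^ 2) fun q hq => ?_).trans
          (Nat.mul_le_mul_right _ hPcard)
        rw [hP, mem_product, mem_erase] at hq
        exact card_affine_relation_le hF _ hq.2.1
    refine h1.trans_lt ?_
    rw [card_univ, Fintype.card_fun, ZMod.card, Fintype.card_fin]
    calc 4 * (E * p ^ 2) + 324 * p ^ 2 = (4 * E + 324) * p ^ 2 := by ring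
      _ < p * p ^ 2 := by gcongr
      _ = p ^ 3 := by ring
  obtain ⟨u, -, hu⟩ := exists_mem_notMem_of_card_lt_card hXcard
  rw [hX, mem_union, not_or] at hu
  obtain ⟨hu1, hu2⟩ := hu
  have hgood : ∀ r, Q r u ∈ quads p → HasSignRelation (F ∘ Q r u) := by
    intro r hr
    by_contra hcon
    exact hu1 (mem_biUnion.2 ⟨r, mem_univ _, mem_filter.2 ⟨mem_univ _,
      mem_badQuads.2 ⟨hr, hcon⟩⟩⟩)
  obtain ⟨a, ha, has⟩ := hgood 0 (by rw [mem_quads]; simp [hQ])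
  obtain ⟨d, hd, hds⟩ := hgood 1 (by rw [mem_quads]; simp [hQ])
  obtain ⟨c, hc, hcs⟩ := hgood 2 (by rw [mem_quads]; simp [hQ]; ring)
  obtain ⟨b, hb, hbs⟩ := hgood 3 (by rw [mem_quads]; simp [hQ])
  rw [mem_relations] at ha hb hc hd
  simp only [Fin.sum_univ_four, hQ, Function.comp_apply, Matrix.cons_val, hF1, hFn1]
    at ha hb hc hd
  have hs : IsSign (c 3 * b 3 * b 0) := ((hcs 3).mul (hbs 3)).mul (hbs 0)
  have hs' : IsSign (c 0 * a 3 * a 0) := ((hcs 0).mul (has 3)).mul (has 0)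
  set e₀ : ZMod p := c 1 * d 3 * d 0 + c 2 with he₀
  set e : Fin 3 → ZMod p := ![c 0 * a 3 * a 1 + c 1 * d 3 * d 2,
    c 3 * b 3 * b 2 + c 0 * a 3 * a 2, c 3 * b 3 * b 1 + c 1 * d 3 * d 1] with he
  have he₀C : e₀ ∈ C := (((hcs 1).mul (hds 3)).mul (hds 0)).add (hcs 2)
  have heC : ∀ i, e i ∈ C := by
    intro i
    fin_cases i
    · exact (((hcs 0).mul (has 3)).mul (has 1)).add (((hcs 1).mul (hds 3)).mul (hds 2))
    · exact (((hcs 3).mul (hbs 3)).mul (hbs 2)).add (((hcs 0).mul (has 3)).mul (has 2))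
    · exact (((hcs 3).mul (hbs 3)).mul (hbs 1)).add (((hcs 1).mul (hds 3)).mul (hds 1))
  have hrel : (c 3 * b 3 * b 0 * F (x + 2) + c 0 * a 3 * a 0 * F x + e₀) +
      ∑ i, e i * F (u i) = 0 := by
    have hb3 := (hbs 3).mul_self
    have ha3 := (has 3).mul_self
    have hd3 := (hds 3).mul_self
    simp only [Fin.sum_univ_three, he, he₀, Matrix.cons_val]
    linear_combination c 3 * b 3 * hb - hc + c 0 * a 3 * ha + c 1 * d 3 * hd -
      c 3 * F (x + 2 + u 2 - u 1) * hb3 - c 0 * F (x + u 0 - u 1) * ha3 -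
      c 1 * F (1 + u 2 - u 0) * hd3
  have hezero : e = 0 := by
    by_contra hne
    refine hu2 (mem_biUnion.2 ⟨((c 3 * b 3 * b 0, c 0 * a 3 * a 0, e₀), e), ?_,
      mem_filter.2 ⟨mem_univ _, hrel⟩⟩)
    simp only [hP, mem_product, mem_erase, Fintype.mem_piFinset]
    exact ⟨⟨hSmem.1 hs, hSmem.1 hs', he₀C⟩, hne, heC⟩
  rw [hezero] at hrel
  simp only [Pi.zero_apply, zero_mul, sum_const_zero, add_zero] at hrel
  have hn1 : IsSign (-1 : ZMod p) := Or.inr rfl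
  refine ⟨-1 * (c 3 * b 3 * b 0) * (c 0 * a 3 * a 0), -1 * (c 3 * b 3 * b 0) * e₀,
    (hn1.mul hs).mul hs', ?_, ?_⟩
  · have hmulC : ∀ t y : ZMod p, IsSign t → y ∈ C → t * y ∈ C := by
      intro t y ht hy
      rw [hC, mem_insert, mem_insert, mem_singleton] at hy ⊢
      rcases ht with rfl | rfl <;> rcases hy with rfl | rfl | rfl <;> simp
    exact hmulC _ _ (hn1.mul hs) he₀C
  · linear_combination (c 3 * b 3 * b 0) * hrel - F (x + 2) * hs.mul_self

/-- An odd injective function whose values at `x` and `x + 2` are always related as for `± id` is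
`± id`. -/
lemma eq_or_eq_neg_of_step {F : ZMod p → ZMod p} (hF : Function.Injective F) (hp : 2 < p)
    (hF1 : F 1 = 1) (hneg : ∀ x, F (-x) = -F x)
    (hstep : ∀ x, x ≠ 0 → x + 2 ≠ 0 →
      ∃ s c, IsSign s ∧ c ∈ ({0, 2, -2} : Finset (ZMod p)) ∧ F (x + 2) = s * F x + c)
    (x : ZMod p) : F x = x ∨ F x = -x := by
  have hpp : p.Prime := Fact.out
  have h2 : (2 : ZMod p) ≠ 0 := by
    intro h
    have : ((2 : ℕ) : ZMod p) = 0 := by exact_mod_cast h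
    rw [ZMod.natCast_eq_zero_iff] at this
    have := Nat.le_of_dvd two_pos this
    omega
  have hF0 : F 0 = 0 := by
    have h := hneg 0
    rw [neg_zero] at h
    have h' : 2 * F 0 = 0 := by linear_combination h
    exact (mul_eq_zero.1 h').resolve_left h2
  have hval : ∀ {y z : ZMod p}, (F y = y ∨ F y = -y) → (F z = y ∨ F z = -y) → z = y ∨ z = -y := by
    intro y z hy hz
    rcases hy with hy | hy <;> rcases hz with hz | hz
    · exact Or.inl (hF (hz.trans hy.symm))
    · exact Or.inr (hF (by rw [hneg, hy, hz]))
    · exact Or.inr (hF (by rw [hneg, hy, hz, neg_neg]))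
    · exact Or.inl (hF (hz.trans hy.symm))
  have hodd : ∀ m : ℕ, 2 * m + 1 < p →
      (F (2 * m - 1) = 2 * m - 1 ∨ F (2 * m - 1) = -(2 * m - 1)) ∧
      (F (2 * m + 1) = 2 * m + 1 ∨ F (2 * m + 1) = -(2 * m + 1)) := by
    intro m
    induction m with
    | zero =>
      intro _
      simp [hneg, hF1]
    | succ m ih =>
      intro hm
      obtain ⟨ih1, ih2⟩ := ih (by omega)
      have hne : ∀ i : ℕ, 0 < i → i < p → (i : ZMod p) ≠ 0 := by
        intro i hi hip h
        rw [ZMod.natCast_eq_zero_iff] at h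
        exact absurd (Nat.le_of_dvd hi h) (by omega)
      set y : ZMod p := 2 * m + 1 with hy
      have hy0 : y ≠ 0 := by
        have := hne (2 * m + 1) (by omega) (by omega)
        push_cast at this
        exact this
      have hy2 : y + 2 ≠ 0 := by
        have := hne (2 * m + 3) (by omega) (by omega)
        push_cast at this
        intro h
        exact this (by linear_combination h)
      have hy1 : y + 1 ≠ 0 := by
        have := hne (2 * m + 2) (by omega) (by omega)
        push_cast at this
        intro h
        exact this (by linear_combination h)
      have e1 : (2 * ((m + 1 : ℕ) : ZMod p) - 1) = y := by push_cast; ring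
      have e2 : (2 * ((m + 1 : ℕ) : ZMod p) + 1) = y + 2 := by push_cast; ring
      have e3 : (2 * (m : ZMod p) - 1) = y - 2 := by rw [hy]; ring
      rw [e1, e2]
      rw [e3] at ih1
      refine ⟨ih2, ?_⟩
      obtain ⟨s, c, hs, hc, hsc⟩ := hstep y hy0 hy2
      have hsF : s * F y = y ∨ s * F y = -y := by
        rcases hs with rfl | rfl <;> rcases ih2 with h | h <;> rw [h] <;> simp
      have hex1 : ¬ (F (y + 2) = y ∨ F (y + 2) = -y) := by
        intro h
        rcases hval ih2 h with h | h
        · exact h2 (by linear_combination h)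
        · refine mul_ne_zero h2 hy1 ?_
          linear_combination h
      have hex2 : ¬ (F (y + 2) = y - 2 ∨ F (y + 2) = -(y - 2)) := by
        intro h
        rcases hval ih1 h with h | h
        · refine mul_ne_zero h2 h2 ?_
          linear_combination h
        · refine mul_ne_zero h2 hy0 ?_
          linear_combination h
      rw [mem_insert, mem_insert, mem_singleton] at hc
      rcases hc with rfl | rfl | rfl <;> rcases hsF with h | h <;> rw [h] at hsc
      · exact absurd (Or.inl (by rw [hsc]; ring)) hex1
      · exact absurd (Or.inr (by rw [hsc]; ring)) hex1
      · exact Or.inl hsc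
      · exact absurd (Or.inr (by rw [hsc]; ring)) hex2
      · exact absurd (Or.inl (by rw [hsc]; ring)) hex2
      · exact Or.inr (by rw [hsc]; ring)
  have hoddval : ∀ i : ℕ, i < p → Odd i → F (i : ZMod p) = i ∨ F (i : ZMod p) = -i := by
    rintro i hi ⟨m, rfl⟩
    have := (hodd m hi).2
    push_cast
    exact this
  have hxv : ((x.val : ℕ) : ZMod p) = x := ZMod.natCast_zmod_val x
  have hlt := ZMod.val_lt x
  rcases Nat.even_or_odd x.val with hev | hod
  · rcases Nat.eq_zero_or_pos x.val with h0 | hpos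
    · rw [h0, Nat.cast_zero] at hxv
      rw [← hxv, hF0]
      simp
    have hpo : Odd p := hpp.odd_of_ne_two (by omega)
    have h := hoddval (p - x.val) (by omega) (Nat.Odd.sub_even hlt.le hpo hev)
    rw [Nat.cast_sub hlt.le, hxv, ZMod.natCast_self, zero_sub, hneg, neg_neg] at h
    rcases h with h | h
    · exact Or.inl (neg_inj.1 h)
    · exact Or.inr (by linear_combination -h)
  · rw [← hxv]
    exact hoddval _ hlt hod

end Rigidity

section PowerMaps

variable {p : ℕ} [Fact p.Prime]

lemma pow_injective_of_coprime {k : ℕ} (hp : 2 < p) (hcop : Nat.gcd k (p - 1) = 1) :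
    Function.Injective fun x : ZMod p => x ^ k := by
  obtain ⟨m, -, hm⟩ := Nat.exists_mul_mod_eq_one_of_coprime (n := k) (k := p - 1) hcop (by omega)
  have hleft : ∀ x : ZMod p, (x ^ k) ^ m = x := by
    intro x
    rw [← pow_mul]
    rcases eq_or_ne x 0 with rfl | hx
    · rw [zero_pow]
      intro h
      rw [h, Nat.zero_mod] at hm
      omega
    · rw [← Nat.mod_add_div (k * m) (p - 1), hm, pow_add, pow_mul, ZMod.pow_card_sub_one_eq_one hx,
        one_pow, pow_one, mul_one]
  exact Function.LeftInverse.injective (g := fun y => y ^ m) hleft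

lemma pow_eq_self_or_neg {n k L₁ L₂ : ℕ} (hn : 2 ≤ n) (hpn : 9 * 10 ^ 34 * n ^ 30 ≤ p)
    (hcop : Nat.gcd k (p - 1) = 1)
    (hL₁ : n * L₁ ≤ p + 2 * n) (hL₁' : p ≤ n * L₁ + 2 * n)
    (hL₂ : n * L₂ ≤ p + 2 * n) (hL₂' : p ≤ n * L₂ + 2 * n)
    {α₁ α₂ c : ZMod p} (hc : c ≠ 0) (hmaps : ∀ y ∈ arc α₁ L₁, c * y ^ k ∈ arc α₂ L₂)
    (x : ZMod p) : x ^ k = x ∨ x ^ k = -x := by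
  have hn0 : 0 < n := by omega
  have h30 : 0 < n ^ 30 := by positivity
  have h18 : n ^ 18 ≤ n ^ 30 := Nat.pow_le_pow_right hn0 (by norm_num)
  have h6 : 1 ≤ n ^ 6 := Nat.one_le_pow _ _ hn0
  have hp2 : 2 < p := by omega
  have hpo : Odd p := (Fact.out : p.Prime).odd_of_ne_two (by omega)
  have hkodd : Odd k := by
    rw [← Nat.not_even_iff_odd]
    intro hev
    have h1 : Even (p - 1) := Nat.Odd.sub_odd hpo odd_one
    have := Nat.dvd_gcd hev.two_dvd h1.two_dvd
    rw [hcop] at this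
    omega
  have hF := pow_injective_of_coprime hp2 hcop
  set N : ℕ := 2 * (10 ^ 10 * n ^ 6) with hN
  have hcard := card_badQuads_le hF (N := N) (by
    intro v hv hgen hgen'
    refine exists_sign_relation hn (le_trans (by gcongr; norm_num) hpn) hL₁ hL₁' hL₂ hL₂' α₁ α₂
      (mem_quads.1 hv) hgen hgen' (s := fun t => c * t ^ k)
      (fun t t' h => hF (mul_left_cancel₀ hc h)) ?_
    intro t ht j
    simp only [Function.comp_apply, mul_assoc, ← mul_pow]
    exact hmaps _ (ht j))
  have hfib : ∀ y : ZMod p, y ≠ 0 → ∀ i, #{v ∈ badQuads fun x : ZMod p => x ^ k | v i = y} ≤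
      16 * (2 * (N + 1)) ^ 3 * p := by
    intro y hy i
    have h1 := (card_badQuads_fiber_le (F := fun x : ZMod p => x ^ k) (fun x y => mul_pow x y k)
      (fun x hx => pow_ne_zero k hx) hy i).trans hcard
    set M := #{v ∈ badQuads fun x : ZMod p => x ^ k | v i = y}
    have h2 : p ≤ 2 * (p - 1) := by omega
    have h3 : p * M ≤ p * (16 * (2 * (N + 1)) ^ 3 * p) := by
      calc p * M ≤ 2 * (p - 1) * M := by gcongr
        _ = 2 * ((p - 1) * M) := by ring
        _ ≤ 2 * (8 * (2 * (N + 1)) ^ 3 * p ^ 2) := by gcongr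
        _ = _ := by ring
    exact Nat.le_of_mul_le_mul_left h3 (by omega)
  have hE : 4 * (16 * (2 * (N + 1)) ^ 3) + 324 < p := by
    have h1 : 2 * (N + 1) ≤ 5 * 10 ^ 10 * n ^ 6 := by omega
    have h2 : (2 * (N + 1)) ^ 3 ≤ (5 * 10 ^ 10) ^ 3 * n ^ 18 := by
      calc _ ≤ (5 * 10 ^ 10 * n ^ 6) ^ 3 := Nat.pow_le_pow_left h1 3
        _ = _ := by ring
    norm_num at h2
    omega
  exact eq_or_eq_neg_of_step hF hp2 (one_pow k) (fun x => hkodd.neg_pow x)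
    (fun x hx hx2 => exists_eq_of_badQuads hF (one_pow k) hkodd.neg_one_pow hfib hE hx hx2) x

lemma eq_one_or_half_of_pow_eq {k : ℕ} (hk : 1 ≤ k) (hk' : k < p - 1)
    (h : ∀ x : ZMod p, x ^ k = x ∨ x ^ k = -x) : k = 1 ∨ k = (p + 1) / 2 := by
  have h1 : ∀ u : (ZMod p)ˣ, u ^ (2 * (k - 1)) = 1 := by
    intro u
    have hu : (u : ZMod p) ^ 2 ≠ 0 := pow_ne_zero 2 u.ne_zero
    ext
    rw [Units.val_pow_eq_pow_val, Units.val_one]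
    refine mul_right_cancel₀ hu ?_
    rw [← pow_add, one_mul, show 2 * (k - 1) + 2 = k * 2 by omega, pow_mul]
    rcases h u with h | h <;> rw [h]
    ring
  have h2 : p - 1 ∣ 2 * (k - 1) := by
    have h3 := Monoid.exponent_dvd_of_forall_pow_eq_one h1
    rwa [IsCyclic.exponent_eq_card, Nat.card_eq_fintype_card, ZMod.card_units] at h3
  obtain ⟨l, hl⟩ := h2
  have hl2 : l < 2 := by
    by_contra! hcon
    have := Nat.mul_le_mul_left (p - 1) hcon
    omega
  interval_cases l <;> omega

end PowerMaps

section QuadraticCharacter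

variable {p : ℕ} [Fact p.Prime]

lemma norm_sum_quadraticChar_le (hp : p ≠ 2) (a : ZMod p) :
    ‖∑ x, ((quadraticChar (ZMod p) x : ℤ) : ℂ) * ZMod.stdAddChar (a * x)‖ ≤ √p := by
  have hchar : ringChar (ZMod p) ≠ 2 := by rwa [ZMod.ringChar_zmod_n]
  rcases eq_or_ne a 0 with rfl | ha
  · have h := quadraticChar_sum_zero (F := ZMod p) hchar
    simp only [zero_mul, AddChar.map_zero_eq_one, mul_one]
    rw [← Int.cast_sum, h]
    simp
  set χ : MulChar (ZMod p) ℂ := (quadraticChar (ZMod p)).ringHomComp (Int.castRingHom ℂ) with hχ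
  have hquad : χ.IsQuadratic := (quadraticChar_isQuadratic (ZMod p)).comp _
  have hne : χ ≠ 1 := by
    rw [hχ, MulChar.ringHomComp_ne_one_iff (RingHom.injective_int _)]
    exact quadraticChar_ne_one hchar
  have hunit : ∀ b : ZMod p, b ≠ 0 → ‖χ b‖ = 1 := by
    intro b hb
    have := quadraticChar_dichotomy hb
    rcases this with h | h <;> simp [hχ, h]
  have hsq := gaussSum_sq hne hquad (ZMod.isPrimitive_stdAddChar p)
  have hnorm : ‖gaussSum χ ZMod.stdAddChar‖ = √p := by
    rw [← Real.sqrt_sq (norm_nonneg (gaussSum χ _)), ← norm_pow, hsq, norm_mul,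
      hunit _ (neg_ne_zero.2 one_ne_zero), ZMod.card, one_mul, Complex.norm_natCast]
  have hshift := gaussSum_mulShift χ ZMod.stdAddChar (Units.mk0 a ha)
  have heq := congrArg norm hshift
  rw [norm_mul, Units.val_mk0, hunit a ha, one_mul, hnorm] at heq
  exact heq.le

/-- The correlation of the quadratic character with two trapezoids. -/
lemma abs_sum_trap_mul_quadraticChar_le (hp : p ≠ 2) {m₁ m₂ K : ℕ} (hm₁ : m₁ ≤ p) (hm₂ : m₂ ≤ p)
    (hK : 0 < K) (hKp : K ≤ p) (α₁ α₂ B : ZMod p) :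
    |∑ y, trap α₁ m₁ K y * ((quadraticChar (ZMod p) y : ℤ) : ℝ) * trap α₂ m₂ K (B * y)|
      ≤ √p * (p / K) := by
  have hexp : ((∑ y, trap α₁ m₁ K y * ((quadraticChar (ZMod p) y : ℤ) : ℝ) *
        trap α₂ m₂ K (B * y) : ℝ) : ℂ) =
      ∑ b, ∑ c, trapCoeff α₁ m₁ K b * trapCoeff α₂ m₂ K c *
        ∑ y, ((quadraticChar (ZMod p) y : ℤ) : ℂ) * ZMod.stdAddChar ((b + c * B) * y) := by
    push_cast
    simp_rw [trap_eq_sum, mul_sum, sum_mul]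
    rw [sum_comm]
    refine (sum_congr rfl fun c _ => sum_comm).trans ?_
    rw [sum_comm]
    refine sum_congr rfl fun b _ => sum_congr rfl fun c _ => sum_congr rfl fun y _ => ?_
    rw [add_mul, AddChar.map_add_eq_mul, mul_assoc c B y]
    ring
  have hsum : ∀ m ≤ p, ∑ b : ZMod p, trapNorm m K b ≤ √(p / K) := by
    intro m hm
    refine Real.le_sqrt_of_sq_le ((sq_sum_trapNorm_le hm hK hKp).trans ?_)
    gcongr
  rw [← Real.norm_eq_abs, ← Complex.norm_real, hexp]
  calc _ ≤ ∑ b : ZMod p, ∑ c : ZMod p, trapNorm m₁ K b * trapNorm m₂ K c * √p := by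
        refine norm_sum_le_of_le _ fun b _ => norm_sum_le_of_le _ fun c _ => ?_
        rw [norm_mul, norm_mul, norm_trapCoeff, norm_trapCoeff]
        exact mul_le_mul_of_nonneg_left (norm_sum_quadraticChar_le hp _)
          (mul_nonneg (trapNorm_nonneg _ _ _) (trapNorm_nonneg _ _ _))
    _ = √p * ((∑ b : ZMod p, trapNorm m₁ K b) * ∑ c : ZMod p, trapNorm m₂ K c) := by
        rw [sum_mul_sum, mul_sum]
        refine sum_congr rfl fun b _ => ?_
        rw [mul_sum]
        exact sum_congr rfl fun c _ => by ring
    _ ≤ √p * (√(p / K) * √(p / K)) := by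
        gcongr
        · exact sum_nonneg fun c _ => trapNorm_nonneg _ _ _
        · exact hsum m₁ hm₁
        · exact hsum m₂ hm₂
    _ = √p * (p / K) := by rw [Real.mul_self_sqrt (by positivity)]

lemma notMem_arc_of_mem_arc_add {α x : ZMod p} {L : ℕ} (hL : L ≤ p)
    (hx : x ∈ arc (α + (L : ZMod p)) (p - L)) : x ∉ arc α L := by
  intro hx'
  obtain ⟨s, hs, rfl⟩ := mem_arc.1 hx
  obtain ⟨t, ht, h⟩ := mem_arc.1 hx'
  have := natCast_inj_of_lt (p := p) (s := L + s) (t := t) (by omega) (by omega) (by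
    rw [add_assoc] at h
    push_cast
    exact add_left_cancel h)
  omega

lemma mem_arc_add_of_notMem_arc {α x : ZMod p} {L : ℕ} (hx : x ∉ arc α L) :
    x ∈ arc (α + (L : ZMod p)) (p - L) := by
  have hval := ZMod.val_lt (x - α)
  have hcast : ((x - α).val : ZMod p) = x - α := ZMod.natCast_zmod_val _
  rcases lt_or_ge (x - α).val L with h | h
  · exact absurd (mem_arc.2 ⟨_, h, by rw [hcast]; ring⟩) hx
  · refine mem_arc.2 ⟨(x - α).val - L, by omega, ?_⟩
    rw [Nat.cast_sub h, hcast]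
    ring

lemma length_le_of_quadraticChar_mul_mem_arc (hp : p ≠ 2) {L₁ L₂ K : ℕ} (hK : 0 < K)
    (hK₁ : K ≤ L₁) (hL₁ : L₁ ≤ p) (hK₂ : L₂ + K ≤ p) {α₁ α₂ B : ZMod p} (hB : B ≠ 0)
    (h0 : (0 : ZMod p) ∉ arc α₁ L₁) (hneg : ∀ z ∈ arc α₂ L₂, -z ∉ arc α₂ L₂)
    (hmaps : ∀ y ∈ arc α₁ L₁, ((quadraticChar (ZMod p) y : ℤ) : ZMod p) * (B * y) ∈ arc α₂ L₂) :
    (L₁ : ℝ) ≤ 3 * K + 2 * (√p * (p / K)) := by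
  set φ : ZMod p → ℝ := trap α₁ (L₁ - K) K
  set θ : ZMod p → ℝ := trap (α₂ + (L₂ : ZMod p)) (p - L₂ - K) K
  set χ : ZMod p → ℝ := fun y => ((quadraticChar (ZMod p) y : ℤ) : ℝ)
  set ι : ZMod p → ℝ := fun z => if z ∈ arc (α₂ + (L₂ : ZMod p)) (p - L₂) then 1 else 0 with hι
  have hφ0 : ∀ y, 0 ≤ φ y := fun y => trap_nonneg _ _ _ _
  have hφ : ∀ y, φ y ≤ if y ∈ arc α₁ L₁ then 1 else 0 := by
    intro y
    have := trap_le_indicator (p := p) (m := L₁ - K) (by omega) α₁ K y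
    rwa [Nat.sub_add_cancel hK₁] at this
  have hφ1 : ∀ y, φ y ≤ 1 := fun y => (hφ y).trans (by split_ifs <;> norm_num)
  have hθ0 : ∀ z, 0 ≤ θ z := fun z => trap_nonneg _ _ _ _
  have hθ : ∀ z, θ z ≤ ι z := by
    intro z
    have := trap_le_indicator (p := p) (m := p - L₂ - K) (by omega) (α₂ + (L₂ : ZMod p)) K z
    rwa [Nat.sub_add_cancel (by omega)] at this
  have hθarc : ∀ z ∈ arc α₂ L₂, θ z = 0 := by
    intro z hz
    refine le_antisymm ((hθ z).trans ?_) (hθ0 z)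
    rw [hι]
    dsimp only
    rw [if_neg]
    exact fun h => notMem_arc_of_mem_arc_add (by omega) h hz
  have hvanish : ∀ y, φ y * (θ (B * y) + θ (-B * y)) =
      φ y * χ y * θ (-B * y) - φ y * χ y * θ (B * y) := by
    intro y
    by_cases hy : y ∈ arc α₁ L₁
    · have hy0 : y ≠ 0 := fun h => h0 (h ▸ hy)
      have hmem := hmaps y hy
      rcases quadraticChar_dichotomy hy0 with h | h
      · have hz : θ (B * y) = 0 := hθarc _ (by simpa [h] using hmem)
        have hχ : χ y = 1 := by simp only [χ, h, Int.cast_one]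
        rw [hz, hχ]
        ring
      · have hz : θ (-B * y) = 0 := hθarc _ (by simpa [h] using hmem)
        have hχ : χ y = -1 := by simp only [χ, h, Int.cast_neg, Int.cast_one]
        rw [hz, hχ]
        ring
    · have : φ y = 0 := le_antisymm ((hφ y).trans (by rw [if_neg hy])) (hφ0 y)
      simp [this]
  have hcover : ∀ z, 1 ≤ ι z + ι (-z) := by
    intro z
    rw [hι]
    dsimp only
    by_cases hz : z ∈ arc α₂ L₂
    · rw [if_pos (mem_arc_add_of_notMem_arc (hneg z hz))]
      split_ifs <;> norm_num
    · rw [if_pos (mem_arc_add_of_notMem_arc hz)]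
      split_ifs <;> norm_num
  have hdefect : ∑ z, (ι z - θ z) ≤ K := by
    rw [sum_sub_distrib, sum_trap hK, hι]
    simp only [sum_boole]
    have hcard : #{z : ZMod p | z ∈ arc (α₂ + (L₂ : ZMod p)) (p - L₂)} ≤ p - L₂ := by
      rw [filter_univ_mem]
      exact card_image_le.trans (card_range _).le
    have h1 : (#{z : ZMod p | z ∈ arc (α₂ + (L₂ : ZMod p)) (p - L₂)} : ℝ) ≤
        ((p - L₂ - K + K : ℕ) : ℝ) := by
      rw [Nat.sub_add_cancel (by omega)]
      exact_mod_cast hcard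
    push_cast at h1 ⊢
    linarith
  have hscale : ∀ c : ZMod p, c ≠ 0 → ∑ y, (ι (c * y) - θ (c * y)) ≤ K := by
    intro c hc
    refine le_trans (le_of_eq ?_) hdefect
    exact Fintype.sum_equiv (Equiv.mulLeft₀ c hc) _ _ fun y => rfl
  have hlower : ∀ y, φ y - (ι (B * y) - θ (B * y)) - (ι (-B * y) - θ (-B * y)) ≤
      φ y * (θ (B * y) + θ (-B * y)) := by
    intro y
    have h1 := hcover (B * y)
    rw [← neg_mul] at h1
    have h2 := hθ (B * y)
    have h3 := hθ (-B * y)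
    nlinarith [hφ0 y, hφ1 y, mul_nonneg (sub_nonneg.2 (hφ1 y)) (add_nonneg (sub_nonneg.2 h2)
      (sub_nonneg.2 h3)), mul_nonneg (hφ0 y) (sub_nonneg.2 h1)]
  have hsum := sum_le_sum fun y (_ : y ∈ (univ : Finset (ZMod p))) => hlower y
  have hsplit : ∑ y, (φ y - (ι (B * y) - θ (B * y)) - (ι (-B * y) - θ (-B * y))) =
      (L₁ - K : ℕ) - ∑ y, (ι (B * y) - θ (B * y)) - ∑ y, (ι (-B * y) - θ (-B * y)) := by
    rw [← sum_trap hK α₁ (L₁ - K), ← sum_sub_distrib, ← sum_sub_distrib]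
  rw [hsplit, Nat.cast_sub hK₁] at hsum
  have hKp : K ≤ p := by omega
  have hb₁ := abs_le.1 (abs_sum_trap_mul_quadraticChar_le hp (m₁ := L₁ - K) (m₂ := p - L₂ - K)
    (by omega) (by omega) hK hKp α₁ (α₂ + (L₂ : ZMod p)) B)
  have hb₂ := abs_le.1 (abs_sum_trap_mul_quadraticChar_le hp (m₁ := L₁ - K) (m₂ := p - L₂ - K)
    (by omega) (by omega) hK hKp α₁ (α₂ + (L₂ : ZMod p)) (-B))
  have hupper := (sum_congr rfl fun y (_ : y ∈ univ) => hvanish y).trans (sum_sub_distrib _ _)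
  have h1 := hscale B hB
  have h2 := hscale (-B) (neg_ne_zero.2 hB)
  linarith [hb₁.1, hb₂.2]

end QuadraticCharacter

section ResidueClasses

lemma exists_forall_mem_Iclass_iff {p n i : ℕ} (hn : 0 < n) (hnp : n < p) (hi : i < n) :
    ∃ a L : ℕ, a ≤ n ∧ a + n * L < p + n ∧ p ≤ a + n * L ∧
      ∀ x, x ∈ Iclass p n i ↔ ∃ t < L, x = a + n * t := by
  obtain ⟨a, ha1, han, hai⟩ : ∃ a, 1 ≤ a ∧ a ≤ n ∧ a % n = i := by
    rcases Nat.eq_zero_or_pos i with rfl | h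
    · exact ⟨n, hn, le_rfl, Nat.mod_self n⟩
    · exact ⟨i, h, hi.le, Nat.mod_eq_of_lt hi⟩
  have hdiv := Nat.div_add_mod (p - 1 - a) n
  have hmod := Nat.mod_lt (p - 1 - a) hn
  refine ⟨a, (p - 1 - a) / n + 1, han, by rw [mul_add]; omega, by rw [mul_add]; omega,
    fun x => ?_⟩
  rw [Iclass, mem_filter, mem_Icc]
  constructor
  · rintro ⟨⟨hx1, hxp⟩, hx⟩
    have hax : a ≤ x := by
      rcases han.lt_or_eq with h | rfl
      · rw [← Nat.mod_eq_of_lt h, hai, ← hx]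
        exact Nat.mod_le _ _
      · rw [Nat.mod_self] at hai
        exact Nat.le_of_dvd hx1 (Nat.dvd_of_mod_eq_zero (hx.trans hai.symm))
    obtain ⟨t, ht⟩ := (Nat.modEq_iff_dvd' hax).1 (hai.trans hx.symm)
    refine ⟨t, Nat.lt_succ_of_le ((Nat.le_div_iff_mul_le hn).2 ?_), by omega⟩
    rw [mul_comm]
    omega
  · rintro ⟨t, ht, rfl⟩
    have := (Nat.le_div_iff_mul_le hn).1 (Nat.le_of_lt_succ ht)
    rw [mul_comm] at this
    exact ⟨⟨by omega, by omega⟩, by rw [Nat.add_mul_mod_self_left, hai]⟩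

lemma pos_and_lt_of_mem_Iclass {p n i x : ℕ} (hx : x ∈ Iclass p n i) : 1 ≤ x ∧ x < p := by
  rw [Iclass, mem_filter, mem_Icc] at hx
  omega

variable {p : ℕ} [Fact p.Prime]

lemma exists_arc_forall_mem_iff {n i : ℕ} (hn : 0 < n) (hnp : n < p) (hi : i < n) :
    ∃ (α : ZMod p) (L : ℕ), n * L ≤ p + 2 * n ∧ p ≤ n * L + 2 * n ∧
      ∀ z, z ∈ arc α L ↔ ((n : ZMod p) * z).val ∈ Iclass p n i := by
  have hn0 : (n : ZMod p) ≠ 0 := by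
    rw [Ne, ZMod.natCast_eq_zero_iff]
    exact Nat.not_dvd_of_pos_of_lt hn hnp
  obtain ⟨a, L, ha, hL, hL', hmem⟩ := exists_forall_mem_Iclass_iff hn hnp hi
  refine ⟨a / n, L, by omega, by omega, fun z => ?_⟩
  rw [mem_arc, hmem]
  refine exists_congr fun t => and_congr_right fun ht => ?_
  have hlt : a + n * t < p := (pos_and_lt_of_mem_Iclass ((hmem _).2 ⟨t, ht, rfl⟩)).2
  constructor
  · rintro rfl
    rw [mul_add, mul_div_cancel₀ _ hn0]
    have := ZMod.val_cast_of_lt hlt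
    push_cast at this
    exact this
  · intro h
    have := ZMod.natCast_zmod_val ((n : ZMod p) * z)
    rw [h] at this
    push_cast at this
    field_simp
    rw [mul_comm, this]

lemma val_neg_mem_Iclass_iff {n j : ℕ} {w : ZMod p} (hw : w.val ∈ Iclass p n j) :
    (-w).val ∈ Iclass p n j ↔ 2 * j ≡ p [MOD n] := by
  have hpos := pos_and_lt_of_mem_Iclass hw
  have : NeZero w := ⟨fun h => by rw [h, ZMod.val_zero] at hpos; omega⟩
  rw [ZMod.val_neg_of_ne_zero]
  rw [Iclass, mem_filter, mem_Icc] at hw ⊢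
  have hsum : p - w.val + w.val = p := by omega
  have hwj : j ≡ w.val [MOD n] := by
    rw [← hw.2]
    exact Nat.mod_modEq _ _
  constructor
  · rintro ⟨-, h⟩
    have h' : j ≡ p - w.val [MOD n] := by
      conv_lhs => rw [← h]
      exact Nat.mod_modEq _ _
    have := h'.add hwj
    rwa [hsum, ← two_mul] at this
  · intro h
    refine ⟨by omega, ?_⟩
    have h' : p - w.val ≡ j [MOD n] := by
      refine Nat.ModEq.add_right_cancel hwj.symm ?_
      rw [hsum, ← two_mul]
      exact h.symm
    rw [h', ← hw.2, Nat.mod_mod]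

/-- A linear map sending one residue class into another is `± 1`. -/
lemma eq_one_or_neg_one_of_mul_mem_Iclass {n i j : ℕ} {A : ℤ} (hn : 2 ≤ n) (hnp : 4 * n < p)
    (hi : i < n) (hA : 2 * |A| < (p : ℤ)) (hA0 : A ≠ 0)
    (hmaps : ∀ x ∈ Iclass p n i, ((A : ZMod p) * (x : ZMod p)).val ∈ Iclass p n j) :
    A = 1 ∨ A = -1 := by
  have hp : p.Prime := Fact.out
  obtain ⟨a, L, ha, hL, hL', hmem⟩ := exists_forall_mem_Iclass_iff (p := p) (by omega) (by omega) hi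
  set g : ℕ → ℕ := fun t => ((A : ZMod p) * ((a + n * t : ℕ) : ZMod p)).val with hg
  have hgmem : ∀ t < L, g t ∈ Iclass p n j := fun t ht => hmaps _ ((hmem _).2 ⟨t, ht, rfl⟩)
  have hn0 : (0 : ℤ) < n := by omega
  have hstep : ∀ t, t + 1 < L → (g (t + 1) : ℤ) = g t + n * A := by
    intro t ht
    have h0 := hgmem t (by omega)
    have h1 := hgmem (t + 1) ht
    have hb0 := pos_and_lt_of_mem_Iclass h0
    have hb1 := pos_and_lt_of_mem_Iclass h1
    rw [Iclass, mem_filter] at h0 h1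
    obtain ⟨m, hm⟩ := (Nat.modEq_iff_dvd (n := n)).1 (h0.2.trans h1.2.symm)
    have hdvd : (p : ℤ) ∣ n * (m - A) := by
      rw [mul_sub, ← hm, ← ZMod.intCast_zmod_eq_zero_iff_dvd, hg]
      push_cast
      rw [ZMod.natCast_zmod_val, ZMod.natCast_zmod_val]
      ring
    have hcop : IsCoprime (p : ℤ) n := by
      rw [Nat.isCoprime_iff_coprime, hp.coprime_iff_not_dvd]
      exact Nat.not_dvd_of_pos_of_lt (by omega) (by omega)
    have hdvd' := hcop.dvd_of_dvd_mul_left hdvd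
    have hm2 : 2 * |m| < p := by
      have : n * |m| < p := by
        rw [← Nat.abs_cast n, ← abs_mul, ← hm, abs_lt]
        omega
      nlinarith [abs_nonneg m]
    have hmA : |m - A| < p := by
      have := abs_sub m A
      omega
    have := Int.eq_zero_of_abs_lt_dvd hdvd' hmA
    rw [sub_eq_zero] at this
    rw [this] at hm
    omega
  have hlin : ∀ t, t < L → (g t : ℤ) = g 0 + n * A * t := by
    intro t
    induction t with
    | zero => simp
    | succ t ih =>
      intro ht
      rw [hstep t ht, ih (by omega)]
      push_cast
      ring
  have hLpos : 0 < L := by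
    rcases Nat.eq_zero_or_pos L with rfl | h
    · omega
    · exact h
  have hlast := hlin (L - 1) (by omega)
  have hb0 := pos_and_lt_of_mem_Iclass (hgmem 0 hLpos)
  have hb1 := pos_and_lt_of_mem_Iclass (hgmem (L - 1) (by omega))
  have habs : |A| * (n * (L - 1 : ℕ)) < p := by
    have h : |A * (n * (L - 1 : ℕ))| < (p : ℤ) := by
      rw [show A * (n * ((L - 1 : ℕ) : ℤ)) = g (L - 1) - g 0 by rw [hlast]; ring, abs_lt]
      omega
    rwa [abs_mul, abs_of_nonneg (by positivity : (0 : ℤ) ≤ n * (L - 1 : ℕ))] at h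
  have hlen : (p : ℤ) ≤ n * (L - 1 : ℕ) + 2 * n := by
    rw [Nat.cast_sub (by omega), mul_sub]
    push_cast
    zify at hL' ha
    linarith
  have hlt : |A| < 2 := by
    by_contra! h
    zify at hnp
    nlinarith
  have := abs_pos.2 hA0
  have hone : |A| = 1 := by omega
  exact (abs_eq one_pos.le).1 hone

lemma pow_half_eq_quadraticChar_mul (hodd : Odd p) (x : ZMod p) :
    x ^ ((p + 1) / 2) = ((quadraticChar (ZMod p) x : ℤ) : ZMod p) * x := by
  have hchar : ringChar (ZMod p) ≠ 2 := by
    rw [ZMod.ringChar_zmod_n]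
    rintro rfl
    exact absurd hodd (by decide)
  obtain ⟨m, hm⟩ := hodd
  rw [quadraticChar_eq_pow_of_char_ne_two' hchar, ZMod.card, ← pow_succ]
  congr 1
  omega

end ResidueClasses

section Main

variable {p : ℕ} [Fact p.Prime]

lemma not_forall_quadraticChar_mul_mem_arc {n L₁ L₂ : ℕ} (hn : 2 ≤ n)
    (hpn : 9 * 10 ^ 34 * n ^ 30 ≤ p) (hL₁ : n * L₁ ≤ p + 2 * n) (hL₁' : p ≤ n * L₁ + 2 * n)
    (hL₂ : n * L₂ ≤ p + 2 * n) {α₁ α₂ B : ZMod p} (hB : B ≠ 0)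
    (h0 : (0 : ZMod p) ∉ arc α₁ L₁) (hneg : ∀ z ∈ arc α₂ L₂, -z ∉ arc α₂ L₂) :
    ¬ ∀ y ∈ arc α₁ L₁, ((quadraticChar (ZMod p) y : ℤ) : ZMod p) * (B * y) ∈ arc α₂ L₂ := by
  intro hmaps
  have hpn4 : 10 ^ 20 * n ^ 4 ≤ p := by
    have : n ^ 4 ≤ n ^ 30 := Nat.pow_le_pow_right (by omega) (by norm_num)
    omega
  have hn4 : n ≤ n ^ 4 := Nat.le_self_pow (by norm_num) n
  obtain ⟨K, hK⟩ : ∃ K, p / (100 * n) = K := ⟨_, rfl⟩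
  have hdiv := Nat.div_add_mod p (100 * n)
  have hmod := Nat.mod_lt p (y := 100 * n) (by omega)
  rw [hK] at hdiv
  have hKn : 100 * (n * K) ≤ p := by rw [← mul_assoc]; omega
  have hKn' : p < 100 * (n * K) + 100 * n := by rw [← mul_assoc]; omega
  have hK0 : 0 < K := by
    by_contra! h
    have : K = 0 := by omega
    subst this
    omega
  have hKL : K ≤ L₁ := by
    refine le_of_mul_le_mul_left ?_ (by omega : 0 < n)
    omega
  have h2K : 2 * K ≤ n * K := Nat.mul_le_mul_right K hn
  have h2L : ∀ L, 2 * L ≤ n * L := fun L => Nat.mul_le_mul_right L hn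
  have h2L₁ := h2L L₁
  have h2L₂ := h2L L₂
  have hle := length_le_of_quadraticChar_mul_mem_arc (by omega) hK0 hKL (by omega) (by omega)
    hB h0 hneg hmaps
  have hnR : (2 : ℝ) ≤ n := by exact_mod_cast hn
  have hKR : (0 : ℝ) < K := by exact_mod_cast hK0
  have hpK : (p : ℝ) / K ≤ 200 * n := by
    rw [div_le_iff₀ hKR]
    have : p ≤ 200 * n * K := by
      rw [mul_assoc]
      omega
    exact_mod_cast this
  have hsp : 10 ^ 10 * (n : ℝ) ^ 2 ≤ √p := by
    refine Real.le_sqrt_of_sq_le ?_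
    have : (10 ^ 20 * n ^ 4 : ℝ) ≤ p := by exact_mod_cast hpn4
    linarith
  have hs := Real.sq_sqrt (Nat.cast_nonneg (α := ℝ) p)
  have h1 : (n : ℝ) * L₁ ≤ 3 * (n * K) + 400 * (n : ℝ) ^ 2 * √p := by
    calc (n : ℝ) * L₁ ≤ n * (3 * K + 2 * (√p * (200 * n))) := by
          refine mul_le_mul_of_nonneg_left (hle.trans ?_) (by linarith)
          gcongr
      _ = _ := by ring
  have h2 : 100 * ((n : ℝ) * K) ≤ p := by exact_mod_cast hKn
  have h3 : (p : ℝ) ≤ n * L₁ + 2 * n := by exact_mod_cast hL₁'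
  have h4 : (10 ^ 20 * n : ℝ) ≤ p := by
    have : 10 ^ 20 * n ≤ p := by omega
    exact_mod_cast this
  have h5 := mul_le_mul_of_nonneg_right hsp (Real.sqrt_nonneg p)
  nlinarith

end Main

end PowerMap

theorem stmt_1 (p n k : ℕ) (A : ℤ) (hp : p.Prime) (hodd : Odd p) (hn : 2 ≤ n)
    (hA : 2 * |A| < (p : ℤ)) (hA0 : ¬ (p : ℤ) ∣ A)
    (hk1 : 1 ≤ k) (hk2 : k < p - 1) (hk3 : Nat.gcd k (p - 1) = 1)
    (hex : (Even n ∧ ¬ ((A = 1 ∨ A = -1) ∧ k = 1)) ∨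
           (Odd n ∧ ¬ ((A = 1 ∨ A = -1) ∧ (k = 1 ∨ k = (p + 1) / 2))))
    (hbig : (9 * 10 ^ 34 : ℝ) * (n : ℝ) ^ ((92 : ℝ) / 3) ≤ (p : ℝ)) :
    ∀ i j : ℕ, i ≤ n - 1 → j ≤ n - 1 →
      ¬ ((Iclass p n i).image (fmap p A k) ⊆ Iclass p n j) := by
  intro i j hi hj hsub
  have : Fact p.Prime := ⟨hp⟩
  have hpn : 9 * 10 ^ 34 * n ^ 30 ≤ p := by
    have h : (n : ℝ) ^ 30 ≤ (n : ℝ) ^ ((92 : ℝ) / 3) := by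
      rw [← Real.rpow_natCast]
      exact Real.rpow_le_rpow_of_exponent_le (by exact_mod_cast (by omega : 1 ≤ n)) (by norm_num)
    have h' : (9 * 10 ^ 34 : ℝ) * (n : ℝ) ^ 30 ≤ p := by linarith
    exact_mod_cast h'
  have hnp : 4 * n < p := by
    have : n ≤ n ^ 30 := Nat.le_self_pow (by norm_num) n
    omega
  have hn0 : (n : ZMod p) ≠ 0 := by
    rw [Ne, ZMod.natCast_eq_zero_iff]
    exact Nat.not_dvd_of_pos_of_lt (by omega) (by omega)
  have hAp : (A : ZMod p) ≠ 0 := by rwa [Ne, ZMod.intCast_zmod_eq_zero_iff_dvd]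
  have hA0' : A ≠ 0 := by
    rintro rfl
    exact hA0 (dvd_zero _)
  have hmaps : ∀ x ∈ Iclass p n i, ((A : ZMod p) * (x : ZMod p) ^ k).val ∈ Iclass p n j :=
    fun x hx => hsub (Finset.mem_image_of_mem _ hx)
  obtain ⟨α₁, L₁, hL₁, hL₁', hmem₁⟩ :=
    PowerMap.exists_arc_forall_mem_iff (p := p) (n := n) (i := i) (by omega) (by omega) (by omega)
  obtain ⟨α₂, L₂, hL₂, hL₂', hmem₂⟩ :=
    PowerMap.exists_arc_forall_mem_iff (p := p) (n := n) (i := j) (by omega) (by omega) (by omega)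
  have hmapsn : ∀ y ∈ PowerMap.arc α₁ L₁,
      ((A : ZMod p) * ((n : ZMod p) * y) ^ k).val ∈ Iclass p n j := by
    intro y hy
    have := hmaps _ ((hmem₁ y).1 hy)
    rwa [ZMod.natCast_zmod_val] at this
  have hpow : ∀ x : ZMod p, x ^ k = x ∨ x ^ k = -x := by
    refine PowerMap.pow_eq_self_or_neg hn hpn hk3 hL₁ hL₁' hL₂ hL₂'
      (α₁ := α₁) (α₂ := α₂) (mul_ne_zero hAp (pow_ne_zero (k - 1) hn0)) fun y hy => ?_
    rw [hmem₂]
    convert hmapsn y hy using 2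
    obtain ⟨m, rfl⟩ := Nat.exists_eq_add_of_le' hk1
    rw [Nat.add_sub_cancel]
    ring
  have hlinear := fun h => PowerMap.eq_one_or_neg_one_of_mul_mem_Iclass (p := p) (n := n) (i := i)
    (j := j) (A := A) hn hnp (by omega) hA hA0' h
  rcases PowerMap.eq_one_or_half_of_pow_eq hk1 hk2 hpow with rfl | rfl
  · have := hlinear fun x hx => by simpa using hmaps x hx
    tauto
  · by_cases hj2 : 2 * j ≡ p [MOD n]
    · have hA1 := hlinear fun x hx => by
        have h := hmaps x hx
        rcases hpow x with hx' | hx' <;> rw [hx'] at h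
        · exact h
        · rw [mul_neg] at h
          rw [← PowerMap.val_neg_mem_Iclass_iff h, neg_neg] at hj2
          exact hj2
      have hnodd : Odd n := by
        rw [← Nat.not_even_iff_odd]
        intro hev
        have := (hj2.of_dvd hev.two_dvd)
        rw [Nat.ModEq, Nat.odd_iff.1 hodd] at this
        omega
      rcases hex with ⟨hev, -⟩ | ⟨-, h⟩
      · exact Nat.not_even_iff_odd.2 hnodd hev
      · exact h ⟨hA1, Or.inr rfl⟩
    · have hχn : ((quadraticChar (ZMod p) (n : ZMod p) : ℤ) : ZMod p) ≠ 0 := by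
        rcases quadraticChar_dichotomy hn0 with h | h <;> simp [h]
      refine PowerMap.not_forall_quadraticChar_mul_mem_arc hn hpn hL₁ hL₁' hL₂
        (mul_ne_zero hχn hAp) (α₁ := α₁) (α₂ := α₂) (fun h => ?_) (fun z hz hz' => ?_)
        fun y hy => ?_
      · have := PowerMap.pos_and_lt_of_mem_Iclass ((hmem₁ 0).1 h)
        rw [mul_zero, ZMod.val_zero] at this
        omega
      · rw [hmem₂] at hz hz'
        rw [mul_neg, PowerMap.val_neg_mem_Iclass_iff hz] at hz'
        exact hj2 hz'
      · rw [hmem₂]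
        convert hmapsn y hy using 2
        rw [PowerMap.pow_half_eq_quadraticChar_mul hodd, map_mul]
        push_cast
        ring
end

section
/- Let p be an odd prime, n ≥ 2 an integer with p > 2n, and A an integer with 0 < |A| < p/2 and A ≠ ±1. Then the linear map f(x) = (A x mod p) on I is not of Type (iii): there are no indices i, j with 0 ≤ i, j ≤ n−1 and f(I_i) ⊆ I_j. -/
theorem dvd_fmap_one_sub (p : ℕ) [NeZero p] (A : ℤ) (x : ℕ) :
    (p : ℤ) ∣ (fmap p A 1 x : ℤ) - A * x := by
  rw [← ZMod.intCast_zmod_eq_zero_iff_dvd]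
  simp [fmap]

/-- Two residues congruent mod `n` whose difference is `A * n` mod `p` differ by exactly
`A * n`. -/
theorem sub_eq_mul_of_dvd {p n : ℕ} {A u v : ℤ} (hp : p.Prime) (hn : 2 ≤ n) (hpn : n < p)
    (hA : 2 * |A| < (p : ℤ)) (hu : 0 < u) (hup : u < p) (hv : 0 < v) (hvp : v < p)
    (hnd : (n : ℤ) ∣ v - u) (hpd : (p : ℤ) ∣ v - u - A * n) : v - u = A * n := by
  obtain ⟨e, he⟩ := hnd
  have hdvd : (p : ℤ) ∣ n * (e - A) := by
    have : (n : ℤ) * (e - A) = v - u - A * n := by rw [he]; ring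
    rwa [this]
  have hdvd' : (p : ℤ) ∣ e - A := by
    refine ((Nat.prime_iff_prime_int.mp hp).dvd_or_dvd hdvd).resolve_left fun h => ?_
    exact absurd (Nat.le_of_dvd (by omega) (Int.natCast_dvd_natCast.mp h)) (by omega)
  have hn' : (2 : ℤ) ≤ n := by exact_mod_cast hn
  have he1 : 2 * |e| < p := by
    have h1 : |(n : ℤ) * e| < p := by rw [← he, abs_lt]; constructor <;> linarith
    rw [abs_mul, Nat.abs_cast] at h1
    nlinarith [abs_nonneg e]
  have h0 : e - A = 0 := by
    refine Int.eq_zero_of_abs_lt_dvd hdvd' ?_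
    linarith [abs_sub e A]
  rw [he, show e = A by linarith]
  ring

theorem stmt_2 (p n : ℕ) (A : ℤ) (hp : p.Prime) (hodd : Odd p) (hn : 2 ≤ n)
    (hpn : 2 * n < p) (hA : 2 * |A| < (p : ℤ)) (hA0 : A ≠ 0)
    (hA1 : A ≠ 1) (hA1' : A ≠ -1) :
    ∀ i j : ℕ, i ≤ n - 1 → j ≤ n - 1 →
      ¬ ((Iclass p n i).image (fmap p A 1) ⊆ Iclass p n j) := by
  intro i j hi hj hsub
  have : NeZero p := ⟨hp.ne_zero⟩
  obtain ⟨a, ha0, han, hai⟩ : ∃ a, 0 < a ∧ a ≤ n ∧ a % n = i := by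
    rcases Nat.eq_zero_or_pos i with h | h
    · exact ⟨n, by omega, le_rfl, by simp [h]⟩
    · exact ⟨i, h, by omega, Nat.mod_eq_of_lt (by omega)⟩
  have hmem : ∀ t, a + t * n < p → 0 < fmap p A 1 (a + t * n) ∧
      fmap p A 1 (a + t * n) < p ∧ fmap p A 1 (a + t * n) % n = j := by
    intro t ht
    have h := hsub (Finset.mem_image_of_mem (fmap p A 1)
      (show a + t * n ∈ Iclass p n i by
        simp only [Iclass, Finset.mem_filter, Finset.mem_Icc, Nat.add_mul_mod_self_right]
        omega))
    simp only [Iclass, Finset.mem_filter, Finset.mem_Icc] at h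
    omega
  have hlin : ∀ t, a + t * n < p →
      (fmap p A 1 (a + t * n) : ℤ) = fmap p A 1 a + A * (t * n) := by
    intro t
    induction t with
    | zero => simp
    | succ t ih =>
      intro ht
      have ht' : a + t * n < p := by rw [add_mul] at ht; omega
      obtain ⟨h1, h2, h3⟩ := hmem t ht'
      obtain ⟨h4, h5, h6⟩ := hmem (t + 1) ht
      have key := sub_eq_mul_of_dvd (A := A) hp hn (by omega) hA (Nat.cast_pos.mpr h1)
        (Nat.cast_lt.mpr h2) (Nat.cast_pos.mpr h4) (Nat.cast_lt.mpr h5)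
        ((Nat.modEq_iff_dvd).mp (h3.trans h6.symm)) (by
          obtain ⟨c, hc⟩ := dvd_sub (dvd_fmap_one_sub p A (a + (t + 1) * n))
            (dvd_fmap_one_sub p A (a + t * n))
          refine ⟨c, ?_⟩
          rw [← hc]
          push_cast
          ring)
      have := ih ht'
      push_cast
      linarith
  have hA2 : 2 ≤ |A| := by
    rcases abs_cases A with h | h <;> omega
  obtain ⟨m, hm1, hm2⟩ : ∃ m, a + m * n < p ∧ p ≤ a + (m + 1) * n := by
    refine ⟨(p - 1 - a) / n, ?_, ?_⟩
    · have := Nat.div_mul_le_self (p - 1 - a) n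
      omega
    · have := Nat.lt_div_mul_add (a := p - 1 - a) (b := n) (by omega)
      rw [add_mul]
      omega
  obtain ⟨hb0, hbp, -⟩ := hmem m hm1
  obtain ⟨ha0', hap, -⟩ : 0 < fmap p A 1 a ∧ fmap p A 1 a < p ∧ fmap p A 1 a % n = j := by
    simpa using hmem 0 (by omega)
  have hl := hlin m hm1
  have hbd : |A| * (m * n) < p := by
    have : |A * ((m : ℤ) * n)| < p := by rw [abs_lt]; constructor <;> omega
    rwa [abs_mul, abs_of_nonneg (by positivity : (0 : ℤ) ≤ (m : ℤ) * n)] at this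
  have hm2' : (p : ℤ) ≤ a + (m + 1) * n := by exact_mod_cast hm2
  have hanz : (a : ℤ) ≤ n := by exact_mod_cast han
  have hnz : (2 : ℤ) ≤ n := by exact_mod_cast hn
  have hmn : (0 : ℤ) ≤ (m : ℤ) * n := by positivity
  have hm : m = 1 := by
    have h1 : (m : ℤ) < 2 := by
      by_contra! h
      nlinarith
    have h2 : m ≠ 0 := by
      rintro rfl
      omega
    omega
  subst hm
  have hA3 : |A| = 2 := by
    have : |A| < 3 := by
      by_contra! h
      push_cast at *
      nlinarith
    omega
  obtain ⟨k, hk⟩ := dvd_fmap_one_sub p A a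
  push_cast at *
  rcases (abs_eq (by norm_num)).mp hA3 with rfl | rfl
  · have h1 : k < 1 := by by_contra! h; nlinarith
    have h2 : -1 < k := by by_contra! h; nlinarith
    obtain rfl : k = 0 := by omega
    omega
  · have h1 : k < 2 := by by_contra! h; nlinarith
    have h2 : 0 < k := by by_contra! h; nlinarith
    obtain rfl : k = 1 := by omega
    omega
end
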